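/- For every integer k ≥ 2 with k ≠ 3, the Lagrange spectrum of continued fractions with partial quotients bounded by k is an initial segment of the classical Lagrange spectrum: L(k) = L ∩ (−∞, √(k²+4k)]. -/

import Mathlib

open Filter Set
open scoped Pointwise

noncomputable section

/-- The `n`-th convergent of the continued fraction `[0; a 0, a 1, a 2, …]`. -/
def cfConv : ℕ → (ℕ → ℕ) → ℝ
  | 0, _ => 0
  | n + 1, a => 1 / (a 0 + cfConv n fun i => a (i + 1))

/-- The value `[0; a 0, a 1, a 2, …]` of the infinite continued fraction with
partial quotients `a 0, a 1, …` (the limit of its convergents). -/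
def cfVal (a : ℕ → ℕ) : ℝ := limUnder atTop fun n => cfConv n a

/-- The sequence of partial quotients obtained by concatenating the finite word `b`
with the sequence `θ`. -/
def app (b : List ℕ) (θ : ℕ → ℕ) : ℕ → ℕ := fun n =>
  if h : n < b.length then b.get ⟨n, h⟩ else θ (n - b.length)

/-- `λ_i(θ) = [a_i; a_{i+1}, …] + [0; a_{i-1}, a_{i-2}, …]` for a bi-infinite
sequence `θ` of partial quotients. -/
def lamCF (θ : ℤ → ℕ) (i : ℤ) : ℝ :=
  (θ i : ℝ) + cfVal (fun n => θ (i + 1 + n)) + cfVal (fun n => θ (i - 1 - n))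

/-- The classical Lagrange spectrum. -/
def LSpec : Set ℝ :=
  {x | ∃ θ : ℤ → ℕ, (∀ i, 1 ≤ θ i) ∧
    IsBoundedUnder (· ≤ ·) atTop (lamCF θ) ∧ x = limsup (lamCF θ) atTop}

/-- The classical Markov spectrum. -/
def MSpec : Set ℝ :=
  {x | ∃ θ : ℤ → ℕ, (∀ i, 1 ≤ θ i) ∧
    BddAbove (Set.range (lamCF θ)) ∧ x = ⨆ i, lamCF θ i}

/-- The Lagrange spectrum `L(k)` of sequences with partial quotients in `{1, …, k}`. -/
def LSpecK (k : ℕ) : Set ℝ :=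
  {x | ∃ θ : ℤ → ℕ, (∀ i, 1 ≤ θ i ∧ θ i ≤ k) ∧ x = limsup (lamCF θ) atTop}

/-- The Markov spectrum `M(k)` of sequences with partial quotients in `{1, …, k}`. -/
def MSpecK (k : ℕ) : Set ℝ :=
  {x | ∃ θ : ℤ → ℕ, (∀ i, 1 ≤ θ i ∧ θ i ≤ k) ∧ x = ⨆ i, lamCF θ i}

lemma cfConv_nonneg (n : ℕ) (a : ℕ → ℕ) : 0 ≤ cfConv n a := by
  induction n generalizing a with
  | zero => simp [cfConv]
  | succ n ih =>
    have := ih fun i => a (i + 1)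
    simp only [cfConv]
    positivity

/-- Two applications of `x ↦ 1 / (a + x)` contract distances by a factor `4`. -/
lemma abs_two_step_sub_le {a b x y : ℝ} (ha : 1 ≤ a) (hb : 1 ≤ b) (hx : 0 ≤ x) (hy : 0 ≤ y) :
    |1 / (a + 1 / (b + x)) - 1 / (a + 1 / (b + y))| ≤ |x - y| / 4 := by
  have key : 1 / (a + 1 / (b + x)) - 1 / (a + 1 / (b + y)) =
      (x - y) / ((a * (b + x) + 1) * (a * (b + y) + 1)) := by
    have h1 : a * (b + x) + 1 ≠ 0 := by positivity
    have h2 : a * (b + y) + 1 ≠ 0 := by positivity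
    have h3 : b + x ≠ 0 := by positivity
    have h4 : b + y ≠ 0 := by positivity
    have h5 : a + 1 / (b + x) ≠ 0 := by positivity
    have h6 : a + 1 / (b + y) ≠ 0 := by positivity
    field_simp
    ring
  have h1 : 2 ≤ a * (b + x) + 1 := by nlinarith
  have h2 : 2 ≤ a * (b + y) + 1 := by nlinarith
  rw [key, abs_div]
  refine div_le_div_of_nonneg_left (abs_nonneg _) (by norm_num) ?_
  rw [abs_of_pos (by positivity)]
  nlinarith

lemma cfConv_mem_Icc (n : ℕ) (a : ℕ → ℕ) (ha : ∀ i, 1 ≤ a i) : cfConv n a ∈ Icc (0 : ℝ) 1 := by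
  refine ⟨cfConv_nonneg n a, ?_⟩
  cases n with
  | zero => simp [cfConv]
  | succ n =>
    have h0 := cfConv_nonneg n fun i => a (i + 1)
    have h1 : (1 : ℝ) ≤ a 0 := by exact_mod_cast ha 0
    simp only [cfConv]
    rw [div_le_one (by positivity)]
    linarith

lemma abs_cfConv_sub_le (N n m : ℕ) (a b : ℕ → ℕ) (ha : ∀ i, 1 ≤ a i) (hb : ∀ i, 1 ≤ b i)
    (hab : ∀ i < 2 * N, a i = b i) (hn : 2 * N ≤ n) (hm : 2 * N ≤ m) :
    |cfConv n a - cfConv m b| ≤ (1 / 4) ^ N := by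
  induction N generalizing n m a b with
  | zero =>
    have h1 := cfConv_mem_Icc n a ha
    have h2 := cfConv_mem_Icc m b hb
    rw [abs_le]
    constructor <;> simp <;> linarith [h1.1, h1.2, h2.1, h2.2]
  | succ N ih =>
    obtain ⟨n, rfl⟩ : ∃ n', n = n' + 2 := ⟨n - 2, by omega⟩
    obtain ⟨m, rfl⟩ : ∃ m', m = m' + 2 := ⟨m - 2, by omega⟩
    have := ih n m (fun i => a (i + 1 + 1)) (fun i => b (i + 1 + 1)) (fun i => ha _) (fun i => hb _)
      (fun i hi => hab _ (by omega)) (by omega) (by omega)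
    simp only [cfConv]
    rw [← hab 0 (by omega), ← hab (0 + 1) (by omega)]
    refine (abs_two_step_sub_le (by exact_mod_cast ha _) (by exact_mod_cast ha _)
      (cfConv_nonneg _ _) (cfConv_nonneg _ _)).trans ?_
    rw [pow_succ]
    linarith

lemma tendsto_cfConv (a : ℕ → ℕ) (ha : ∀ i, 1 ≤ a i) :
    Tendsto (fun n => cfConv n a) atTop (nhds (cfVal a)) := by
  have hc : CauchySeq fun n => cfConv n a := by
    rw [Metric.cauchySeq_iff]
    intro ε hε
    obtain ⟨N, hN⟩ := exists_pow_lt_of_lt_one hε (by norm_num : (1 / 4 : ℝ) < 1)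
    refine ⟨2 * N, fun m hm n hn => ?_⟩
    rw [Real.dist_eq]
    exact (abs_cfConv_sub_le N m n a a ha ha (fun _ _ => rfl) hm hn).trans_lt hN
  exact hc.tendsto_limUnder

lemma cfVal_nonneg (a : ℕ → ℕ) (ha : ∀ i, 1 ≤ a i) : 0 ≤ cfVal a :=
  ge_of_tendsto' (tendsto_cfConv a ha) fun n => cfConv_nonneg n a

lemma cfVal_eq (a : ℕ → ℕ) (ha : ∀ i, 1 ≤ a i) :
    cfVal a = 1 / (a 0 + cfVal fun i => a (i + 1)) := by
  have h1 := (tendsto_cfConv a ha).comp (tendsto_add_atTop_nat 1)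
  have h2 := tendsto_cfConv (fun i => a (i + 1)) fun i => ha _
  have h0 : (1 : ℝ) ≤ a 0 := by exact_mod_cast ha 0
  have h3 := cfVal_nonneg (fun i => a (i + 1)) fun i => ha _
  refine tendsto_nhds_unique h1 ?_
  exact (tendsto_const_nhds.div (tendsto_const_nhds.add h2) (by positivity))

lemma cfVal_pos (a : ℕ → ℕ) (ha : ∀ i, 1 ≤ a i) : 0 < cfVal a := by
  have h0 : (1 : ℝ) ≤ a 0 := by exact_mod_cast ha 0
  have h3 := cfVal_nonneg (fun i => a (i + 1)) fun i => ha _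
  rw [cfVal_eq a ha]
  positivity

lemma cfVal_lt_inv (a : ℕ → ℕ) (ha : ∀ i, 1 ≤ a i) {d : ℝ} (hd : 0 < d) (h : d ≤ a 0) :
    cfVal a < 1 / d := by
  have h3 := cfVal_pos (fun i => a (i + 1)) fun i => ha _
  rw [cfVal_eq a ha]
  exact one_div_lt_one_div_of_lt hd (by linarith)

lemma cfVal_lt_one (a : ℕ → ℕ) (ha : ∀ i, 1 ≤ a i) : cfVal a < 1 := by
  have := cfVal_lt_inv a ha one_pos (by exact_mod_cast ha 0)
  simpa using this

lemma inv_lt_cfVal (a : ℕ → ℕ) (ha : ∀ i, 1 ≤ a i) {d : ℝ} (h : a 0 ≤ d) :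
    1 / (d + 1) < cfVal a := by
  have h0 : (1 : ℝ) ≤ a 0 := by exact_mod_cast ha 0
  have h3 := cfVal_lt_one (fun i => a (i + 1)) fun i => ha _
  have h4 := cfVal_nonneg (fun i => a (i + 1)) fun i => ha _
  rw [cfVal_eq a ha]
  exact one_div_lt_one_div_of_lt (by positivity) (by linarith)

lemma abs_cfVal_sub_le (N : ℕ) (a b : ℕ → ℕ) (ha : ∀ i, 1 ≤ a i) (hb : ∀ i, 1 ≤ b i)
    (hab : ∀ i < 2 * N, a i = b i) : |cfVal a - cfVal b| ≤ (1 / 4) ^ N :=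
  le_of_tendsto ((tendsto_cfConv a ha).sub (tendsto_cfConv b hb)).abs
    (eventually_atTop.2 ⟨2 * N, fun n hn => abs_cfConv_sub_le N n n a b ha hb hab hn hn⟩)

lemma continuousOn_cfVal : ContinuousOn cfVal {a | ∀ i, 1 ≤ a i} := by
  intro a ha
  rw [ContinuousWithinAt, Metric.tendsto_nhds]
  intro ε hε
  obtain ⟨N, hN⟩ := exists_pow_lt_of_lt_one hε (by norm_num : (1 / 4 : ℝ) < 1)
  have h1 : ∀ᶠ b in nhds a, ∀ i ∈ Finset.range (2 * N), b i = a i := by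
    rw [Finset.eventually_all]
    intro i _
    exact (continuous_apply i).continuousAt.eventually
      (isOpen_discrete {a i} |>.mem_nhds rfl)
  filter_upwards [nhdsWithin_le_nhds h1, self_mem_nhdsWithin] with b hb hb'
  rw [Real.dist_eq]
  exact (abs_cfVal_sub_le N b a hb' ha fun i hi => hb i (Finset.mem_range.2 hi)).trans_lt hN

lemma lamCF_le_add_two (θ : ℤ → ℕ) (hθ : ∀ i, 1 ≤ θ i) (i : ℤ) : lamCF θ i ≤ θ i + 2 := by
  have h1 := cfVal_lt_one (fun n : ℕ => θ (i + 1 + n)) fun _ => hθ _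
  have h2 := cfVal_lt_one (fun n : ℕ => θ (i - 1 - n)) fun _ => hθ _
  unfold lamCF
  linarith

lemma lt_lamCF (θ : ℤ → ℕ) (hθ : ∀ i, 1 ≤ θ i) (i : ℤ) : (θ i : ℝ) < lamCF θ i := by
  have h1 := cfVal_pos (fun n : ℕ => θ (i + 1 + n)) fun _ => hθ _
  have h2 := cfVal_pos (fun n : ℕ => θ (i - 1 - n)) fun _ => hθ _
  unfold lamCF
  linarith

lemma abs_lamCF_sub_le (N : ℕ) (θ η : ℤ → ℕ) (hθ : ∀ i, 1 ≤ θ i) (hη : ∀ i, 1 ≤ η i) (i p : ℤ)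
    (h : ∀ q : ℤ, |q| ≤ 2 * N → θ (i + q) = η (p + q)) :
    |lamCF θ i - lamCF η p| ≤ 2 * (1 / 4) ^ N := by
  have h1 := abs_cfVal_sub_le N (fun n : ℕ => θ (i + 1 + n)) (fun n : ℕ => η (p + 1 + n))
    (fun _ => hθ _) (fun _ => hη _) fun n hn => by
      simpa only [add_assoc] using h (1 + n) (by rw [abs_le]; constructor <;> omega)
  have h2 := abs_cfVal_sub_le N (fun n : ℕ => θ (i - 1 - n)) (fun n : ℕ => η (p - 1 - n))
    (fun _ => hθ _) (fun _ => hη _) fun n hn => by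
      have := h (-1 - n) (by rw [abs_le]; constructor <;> omega)
      convert this using 2 <;> ring
  have h3 : θ i = η p := by simpa using h 0 (by simp)
  unfold lamCF
  rw [h3]
  rw [abs_le] at *
  constructor <;> linarith [h1.1, h1.2, h2.1, h2.2]

lemma limsup_eq_of_eventually_frequently {f : ℤ → ℝ} {t : ℝ}
    (h1 : ∀ ε > 0, ∀ᶠ i in atTop, f i ≤ t + ε) (h2 : ∀ ε > 0, ∃ᶠ i in atTop, t - ε ≤ f i) :
    limsup f atTop = t := by
  have hb : IsBoundedUnder (· ≤ ·) atTop f := ⟨t + 1, by simpa using h1 1 one_pos⟩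
  have hc : IsCoboundedUnder (· ≤ ·) atTop f :=
    IsCoboundedUnder.of_frequently_ge (h2 1 one_pos)
  apply le_antisymm
  · refine le_of_forall_pos_le_add fun ε hε => limsup_le_of_le hc (h1 ε hε)
  · refine le_of_forall_pos_le_add fun ε hε => ?_
    have := le_limsup_of_frequently_le (h2 ε hε) hb
    linarith

/-- Abstract form of Hall's theorem on sums of Cantor sets. A node `n` carries an interval
`[l n, r n]` from which an open gap of length `g n` is removed, leaving the intervals of two
further nodes; `E n` is a set of points containing `l n`. -/
lemma exists_abs_add_sub_le_of_split {ν : Type*} (l r g : ν → ℝ) (E : ν → Set ℝ) (C : ℝ)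
    (hl : ∀ n, l n ∈ E n) (hg : ∀ n, 0 < g n) (hlr : ∀ n, l n ≤ r n)
    (hC : ∀ n, r n - l n ≤ C * g n)
    (split : ∀ n, ∃ c d, l c = l n ∧ r d = r n ∧ l d - r c = g n ∧ g n ≤ r c - l c ∧
      g n ≤ r d - l d ∧ g c ≤ g n ∧ g d ≤ g n ∧ E c ⊆ E n ∧ E d ⊆ E n)
    (a b : ν) (hab : g a ≤ r b - l b) (hba : g b ≤ r a - l a) (s : ℝ)
    (hs : s ∈ Icc (l a + l b) (r a + r b)) (ε : ℝ) (hε : 0 < ε) :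
    ∃ x ∈ E a, ∃ y ∈ E b, |x + y - s| ≤ ε := by
  obtain ⟨δ, hδ, hCδ⟩ : ∃ δ > 0, 2 * C * δ ≤ ε := by
    refine ⟨ε / (2 * (|C| + 1)), by positivity, ?_⟩
    rw [mul_div_assoc', div_le_iff₀ (by positivity)]
    nlinarith [le_abs_self C]
  obtain ⟨N, hN⟩ : ∃ N : ℕ, (r a - l a) + (r b - l b) ≤ N * δ := by
    obtain ⟨N, hN⟩ := exists_nat_ge (((r a - l a) + (r b - l b)) / δ)
    exact ⟨N, (div_le_iff₀ hδ).1 hN⟩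
  have hCn : ∀ n, 0 ≤ C := fun n => by
    by_contra! h
    nlinarith [hC n, hlr n, hg n]
  have hC0 := hCn a
  induction N generalizing a b with
  | zero =>
    exfalso
    have h1 := hg a
    have h2 := hg b
    simp only [Nat.cast_zero, zero_mul] at hN
    linarith
  | succ N ih =>
    push_cast at hN
    by_cases hsmall : g a ≤ δ ∧ g b ≤ δ
    · refine ⟨l a, hl a, l b, hl b, ?_⟩
      have h1 := hC a
      have h2 := hC b
      have h3 := mul_le_mul_of_nonneg_left hsmall.1 hC0
      have h4 := mul_le_mul_of_nonneg_left hsmall.2 hC0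
      rw [abs_le]
      constructor <;> linarith [hs.1, hs.2]
    · by_cases hcmp : g b ≤ g a
      · have hδa : δ < g a := by
          by_contra! h
          exact hsmall ⟨h, hcmp.trans h⟩
        obtain ⟨c, d, h1, h2, h3, h4, h5, h6, h7, h8, h9⟩ := split a
        by_cases hcs : s ≤ r c + r b
        · obtain ⟨x, hx, y, hy, hxy⟩ := ih c b (h6.trans hab) (hcmp.trans h4)
            ⟨by linarith [hs.1], hcs⟩ (by linarith)
          exact ⟨x, h8 hx, y, hy, hxy⟩
        · obtain ⟨x, hx, y, hy, hxy⟩ := ih d b (h7.trans hab) (hcmp.trans h5)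
            ⟨by linarith, by linarith [hs.2]⟩ (by linarith)
          exact ⟨x, h9 hx, y, hy, hxy⟩
      · push Not at hcmp
        have hδb : δ < g b := by
          by_contra! h
          exact hsmall ⟨hcmp.le.trans h, h⟩
        obtain ⟨c, d, h1, h2, h3, h4, h5, h6, h7, h8, h9⟩ := split b
        by_cases hcs : s ≤ r a + r c
        · obtain ⟨x, hx, y, hy, hxy⟩ := ih a c (hcmp.le.trans h4) (h6.trans hba)
            ⟨by linarith [hs.1], hcs⟩ (by linarith)
          exact ⟨x, hx, y, h8 hy, hxy⟩
        · obtain ⟨x, hx, y, hy, hxy⟩ := ih a d (hcmp.le.trans h5) (h7.trans hba)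
            ⟨by linarith, by linarith [hs.2]⟩ (by linarith)
          exact ⟨x, hx, y, h9 hy, hxy⟩

/-- `φ` is a Möbius map without pole on `[0, ∞)`; `σ` is the sign of its derivative. -/
structure IsMob (φ : ℝ → ℝ) (A r σ : ℝ) : Prop where
  A_pos : 0 < A
  r_nonneg : 0 ≤ r
  sign : σ = 1 ∨ σ = -1
  sub_eq : ∀ u v, 0 ≤ u → 0 ≤ v → φ u - φ v = σ * (u - v) / (A * (1 + r * u) * (1 + r * v))

namespace IsMob

variable {φ : ℝ → ℝ} {A r σ : ℝ}

lemma id_isMob : IsMob id 1 0 1 := ⟨one_pos, le_rfl, Or.inl rfl, fun u v _ _ => by simp⟩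

lemma comp_inv (hφ : IsMob φ A r σ) {d : ℝ} (hd : 0 < d) :
    IsMob (fun u => φ (1 / (d + u))) (A * (d + r) ^ 2) (1 / (d + r)) (-σ) := by
  have hA := hφ.A_pos
  have hr := hφ.r_nonneg
  refine ⟨by positivity, by positivity, ?_, fun u v hu hv => ?_⟩
  · rcases hφ.sign with h | h <;> simp [h]
  · rw [hφ.sub_eq _ _ (by positivity) (by positivity)]
    have h1 : d + u ≠ 0 := by positivity
    have h2 : d + v ≠ 0 := by positivity
    have h3 : d + r ≠ 0 := by positivity
    have h4 : d + u + r ≠ 0 := by positivity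
    have h5 : d + v + r ≠ 0 := by positivity
    have e1 : 1 + r * (1 / (d + u)) = (d + u + r) / (d + u) := by field_simp
    have e2 : 1 + r * (1 / (d + v)) = (d + v + r) / (d + v) := by field_simp
    have e3 : 1 + 1 / (d + r) * u = (d + u + r) / (d + r) := by field_simp; ring
    have e4 : 1 + 1 / (d + r) * v = (d + v + r) / (d + r) := by field_simp; ring
    rw [e1, e2, e3, e4]
    field_simp
    ring

lemma apply_inv_sub (hφ : IsMob φ A r σ) {x y : ℝ} (hx : 0 < x) (hy : 0 < y) :
    φ (1 / x) - φ (1 / y) = σ * ((y - x) / (A * (x + r) * (y + r))) := by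
  have hA := hφ.A_pos
  have hr := hφ.r_nonneg
  rw [hφ.sub_eq _ _ (by positivity) (by positivity)]
  have h1 : x + r ≠ 0 := by positivity
  have h2 : y + r ≠ 0 := by positivity
  have e1 : 1 + r * (1 / x) = (x + r) / x := by field_simp
  have e2 : 1 + r * (1 / y) = (y + r) / y := by field_simp
  rw [e1, e2]
  field_simp

lemma continuousOn (hφ : IsMob φ A r σ) : ContinuousOn φ (Ici 0) := by
  have hA := hφ.A_pos
  have hr := hφ.r_nonneg
  have h : EqOn φ (fun u => φ 0 + σ * u / (A * (1 + r * u))) (Ici 0) := fun u hu => by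
    have := hφ.sub_eq u 0 hu le_rfl
    simp only [sub_zero, mul_zero, add_zero, mul_one] at this
    simp only
    linarith
  refine ContinuousOn.congr ?_ h
  refine continuousOn_const.add (ContinuousOn.div (by fun_prop) (by fun_prop) fun u hu => ?_)
  have : 0 ≤ u := hu
  positivity

end IsMob

/-- The sequence with first term `d` followed by `u`. -/
def consSeq (d : ℕ) (u : ℕ → ℕ) : ℕ → ℕ
  | 0 => d
  | n + 1 => u n

lemma one_le_consSeq {d : ℕ} {u : ℕ → ℕ} (hd : 1 ≤ d) (hu : ∀ i, 1 ≤ u i) (i : ℕ) :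
    1 ≤ consSeq d u i := by
  cases i with
  | zero => exact hd
  | succ i => exact hu i

lemma cfVal_consSeq {d : ℕ} {u : ℕ → ℕ} (hd : 1 ≤ d) (hu : ∀ i, 1 ≤ u i) :
    cfVal (consSeq d u) = 1 / (d + cfVal u) :=
  cfVal_eq _ (one_le_consSeq hd hu)

/-- Sequences with terms in `{1, …, H}` in which `1` is only followed by terms `≤ h`. -/
def Adm (h H : ℕ) (u : ℕ → ℕ) : Prop :=
  ∀ i, 1 ≤ u i ∧ u i ≤ H ∧ (u i = 1 → u (i + 1) ≤ h)

lemma Adm.one_le {h H : ℕ} {u : ℕ → ℕ} (hu : Adm h H u) (i : ℕ) : 1 ≤ u i := (hu i).1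

lemma Adm.consSeq {h H d : ℕ} {u : ℕ → ℕ} (hu : Adm h H u) (hd : 1 ≤ d) (hdH : d ≤ H)
    (hd1 : d = 1 → u 0 ≤ h) : Adm h H (consSeq d u) := by
  intro i
  cases i with
  | zero => exact ⟨hd, hdH, hd1⟩
  | succ i => exact hu i

/-- The periodic sequence `1, h, 1, h, …`. -/
def altSeq (h : ℕ) (n : ℕ) : ℕ := if Even n then 1 else h

lemma altSeq_eq (h : ℕ) : altSeq h = consSeq 1 (consSeq h (altSeq h)) := by
  funext n
  match n with
  | 0 => simp [altSeq, consSeq]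
  | 1 => simp [altSeq, consSeq]
  | n + 2 => simp [altSeq, consSeq, Nat.even_add]

lemma one_le_altSeq {h : ℕ} (hh : 1 ≤ h) (i : ℕ) : 1 ≤ altSeq h i := by
  unfold altSeq
  split_ifs <;> omega

lemma adm_altSeq {h H : ℕ} (hh : 1 ≤ h) (hH : h ≤ H) : Adm h H (altSeq h) := by
  intro i
  refine ⟨one_le_altSeq hh i, ?_, fun _ => ?_⟩ <;> unfold altSeq <;> split_ifs <;> omega

lemma cfVal_altSeq {h : ℕ} (hh : 1 ≤ h) :
    cfVal (altSeq h) = 1 / (1 + 1 / (h + cfVal (altSeq h))) := by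
  have h1 := one_le_altSeq hh
  conv_lhs => rw [altSeq_eq, cfVal_consSeq le_rfl (one_le_consSeq hh h1), cfVal_consSeq hh h1]
  simp

/-- The parameters of the Cantor set of values of sequences in `Adm h H`: the largest value `M`,
the smallest value `m`, and the smallest value `n` after a partial quotient `1`. -/
structure CantorData where
  h : ℕ
  H : ℕ
  M : ℝ
  m : ℝ
  n : ℝ
  three_le : 3 ≤ h
  h_le : h ≤ H
  M_def : M = cfVal (altSeq h)
  n_def : n = 1 / (h + M)
  m_def : m = 1 / (H + M)
  M_ge : 0.79 ≤ M
  n_le : n ≤ 0.264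
  m_le : m ≤ 0.209

namespace CantorData

variable (D : CantorData)

lemma one_le_h : 1 ≤ D.h := by have := D.three_le; omega

lemma M_lt_one : D.M < 1 := by
  rw [D.M_def]
  exact cfVal_lt_one _ (one_le_altSeq D.one_le_h)

lemma M_eq : D.M = 1 / (1 + D.n) := by
  rw [D.n_def, D.M_def]
  exact cfVal_altSeq D.one_le_h

lemma m_pos : 0 < D.m := by
  rw [D.m_def]
  have := D.M_ge
  positivity

lemma m_le_n : D.m ≤ D.n := by
  rw [D.m_def, D.n_def]
  have := D.M_ge
  have := D.three_le
  have h2 : (D.h : ℝ) ≤ D.H := by exact_mod_cast D.h_le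
  apply one_div_le_one_div_of_le <;> [positivity; linarith]

/-- The largest partial quotient allowed after `d`. -/
def top (d : ℕ) : ℕ := if d = 1 then D.h else D.H

/-- The smallest value of an admissible continuation after `d`. -/
def lo (d : ℕ) : ℝ := if d = 1 then D.n else D.m

lemma lo_eq (d : ℕ) : D.lo d = 1 / (D.top d + D.M) := by
  unfold lo top
  split_ifs
  · exact D.n_def
  · exact D.m_def

lemma lo_pos (d : ℕ) : 0 < D.lo d := by
  have := D.m_pos
  have := D.m_le_n
  unfold lo
  split_ifs <;> linarith

lemma lo_le (d : ℕ) : D.lo d ≤ D.n := by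
  have := D.m_le_n
  unfold lo
  split_ifs <;> linarith

lemma three_le_top (d : ℕ) : 3 ≤ D.top d := by
  have := D.three_le
  have := D.h_le
  unfold top
  split_ifs <;> omega

lemma top_le (d : ℕ) : D.top d ≤ D.H := by
  have := D.h_le
  unfold top
  split_ifs <;> omega

lemma top_one_le {d : ℕ} (hd : d = 1) : D.top d ≤ D.h := by
  simp [top, hd]

/-- A Möbius image of the set of values of admissible sequences with first term in `[j, t]`. -/
structure Node where
  φ : ℝ → ℝ
  A : ℝ
  r : ℝ
  σ : ℝ
  j : ℕ
  t : ℕ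
  mob : IsMob φ A r σ
  one_le_j : 1 ≤ j
  j_lt_t : j < t
  t_le : t ≤ D.H
  thick : (1 + D.m - D.M) * (t + D.M + r) ≤ (D.M - D.m) * (t - 1 + D.M + r)

lemma thick_of_three_le {t : ℕ} (ht : 3 ≤ t) {r : ℝ} (hr : 0 ≤ r) :
    (1 + D.m - D.M) * (t + D.M + r) ≤ (D.M - D.m) * (t - 1 + D.M + r) := by
  have ht' : (3 : ℝ) ≤ t := by exact_mod_cast ht
  have h1 := D.M_ge
  have h2 := D.m_le
  nlinarith [D.m_pos, D.M_lt_one, mul_nonneg (by linarith : 0 ≤ 2 * D.M - 2 * D.m - 1)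
    (by linarith : 0 ≤ (t : ℝ) - 3 + (D.M - 0.79) + r)]

namespace Node

variable {D}
variable (N : D.Node)

/-- The set of points of the Cantor set of the node. -/
def pts : Set ℝ := {x | ∃ u, Adm D.h D.H u ∧ N.j ≤ u 0 ∧ u 0 ≤ N.t ∧ N.φ (cfVal u) = x}

/-- The image of the smallest value. -/
def e₀ : ℝ := N.φ (1 / (N.t + D.M))

/-- The image of the largest value. -/
def e₁ : ℝ := N.φ (1 / (N.j + D.lo N.j))

/-- The length of the gap between first terms `j` and `j + 1`. -/
def gap : ℝ := (1 + D.m - D.M) / (N.A * (N.j + 1 + D.m + N.r) * (N.j + D.M + N.r))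

/-- The length of the hull. -/
def len : ℝ :=
  (N.t + D.M - (N.j + D.lo N.j)) / (N.A * (N.t + D.M + N.r) * (N.j + D.lo N.j + N.r))

/-- The node obtained by fixing the first term to be `d`. -/
def child (d : ℕ) (hd : 1 ≤ d) : D.Node where
  φ := fun u => N.φ (1 / (d + u))
  A := N.A * (d + N.r) ^ 2
  r := 1 / (d + N.r)
  σ := -N.σ
  j := 1
  t := D.top d
  mob := N.mob.comp_inv (by exact_mod_cast hd)
  one_le_j := le_rfl
  j_lt_t := by have := D.three_le_top d; omega
  t_le := D.top_le d
  thick := D.thick_of_three_le (D.three_le_top d) <| by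
    have := N.mob.r_nonneg
    positivity

lemma child_e₀ (d : ℕ) (hd : 1 ≤ d) : (N.child d hd).e₀ = N.φ (1 / (d + D.lo d)) := by
  simp [e₀, child, lo_eq]

lemma child_e₁ (d : ℕ) (hd : 1 ≤ d) : (N.child d hd).e₁ = N.φ (1 / (d + D.M)) := by
  simp [e₁, child, lo, D.M_eq]

lemma child_pts_subset (d : ℕ) (hd : 1 ≤ d) (hj : N.j ≤ d) (ht : d ≤ N.t) :
    (N.child d hd).pts ⊆ N.pts := by
  rintro x ⟨u, hu, -, h2, rfl⟩
  refine ⟨consSeq d u, hu.consSeq hd (ht.trans N.t_le) fun h => h2.trans (D.top_one_le h), hj, ht, ?_⟩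
  rw [cfVal_consSeq hd hu.one_le]
  rfl

lemma child_gap_le (d : ℕ) (hd : 1 ≤ d) (hj : N.j ≤ d) : (N.child d hd).gap ≤ N.gap := by
  have hr := N.mob.r_nonneg
  have hA := N.mob.A_pos
  have hd' : (1 : ℝ) ≤ d := by exact_mod_cast hd
  have hj' : (N.j : ℝ) ≤ d := by exact_mod_cast hj
  have h1 := D.m_pos
  have h2 := D.M_ge
  have h3 := D.M_lt_one
  have e : N.A * (d + N.r) ^ 2 * (((1 : ℕ) : ℝ) + 1 + D.m + 1 / (d + N.r)) *
      (((1 : ℕ) : ℝ) + D.M + 1 / (d + N.r)) =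
      N.A * ((2 + D.m) * (d + N.r) + 1) * ((1 + D.M) * (d + N.r) + 1) := by
    have : (d : ℝ) + N.r ≠ 0 := by positivity
    field_simp
    push_cast
    ring
  simp only [gap, child]
  rw [e]
  apply div_le_div_of_nonneg_left (by linarith) (by positivity)
  have h4 : N.j + 1 + D.m + N.r ≤ (2 + D.m) * (d + N.r) + 1 := by nlinarith
  have h5 : N.j + D.M + N.r ≤ (1 + D.M) * (d + N.r) + 1 := by nlinarith
  exact mul_le_mul (mul_le_mul_of_nonneg_left h4 hA.le) h5 (by positivity) (by positivity)

/-- The node with the first term `j` removed. -/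
def tail (h : N.j + 1 < N.t) : D.Node :=
  { N with
    j := N.j + 1
    one_le_j := by omega
    j_lt_t := h }

lemma lo_succ : D.lo (N.j + 1) = D.m := by
  have := N.one_le_j
  simp only [lo]
  rw [if_neg (by omega)]

/-- The node of all first terms `> j`. -/
lemma exists_left : ∃ c : D.Node, (c.e₀ = N.e₀ ∧ c.e₁ = N.φ (1 / (N.j + 1 + D.m)) ∨
    c.e₁ = N.e₀ ∧ c.e₀ = N.φ (1 / (N.j + 1 + D.m))) ∧ c.gap ≤ N.gap ∧ c.pts ⊆ N.pts := by
  by_cases h : N.j + 1 < N.t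
  · refine ⟨N.tail h, Or.inl ⟨rfl, ?_⟩, ?_, ?_⟩
    · simp [e₁, tail, lo_succ]
    · have hr := N.mob.r_nonneg
      have hA := N.mob.A_pos
      have h1 := D.m_pos
      have h2 := D.M_ge
      have h3 := D.M_lt_one
      simp only [gap, tail]
      apply div_le_div_of_nonneg_left (by linarith) (by positivity)
      push_cast
      gcongr <;> linarith
    · rintro x ⟨u, hu, h1, h2, rfl⟩
      have h1 : N.j + 1 ≤ u 0 := h1
      exact ⟨u, hu, by omega, h2, rfl⟩
  · have h1 : N.t = N.j + 1 := by have := N.j_lt_t; omega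
    refine ⟨N.child (N.j + 1) (by omega), Or.inr ⟨?_, ?_⟩, ?_, ?_⟩
    · rw [child_e₁, e₀, h1]
    · rw [child_e₀, lo_succ]
      push_cast
      rfl
    · exact N.child_gap_le _ _ (by omega)
    · exact N.child_pts_subset _ _ (by omega) (by omega)

lemma gap_pos : 0 < N.gap := by
  have hr := N.mob.r_nonneg
  have hA := N.mob.A_pos
  have h1 := D.m_pos
  have h2 := D.M_ge
  have h3 := D.M_lt_one
  refine div_pos (by linarith) (by positivity)

lemma len_pos_aux : 0 < N.t + D.M - (N.j + D.lo N.j) := by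
  have h : (N.j : ℝ) + 1 ≤ N.t := by exact_mod_cast N.j_lt_t
  have := D.lo_le N.j
  have := D.n_le
  have := D.M_ge
  linarith

lemma len_pos : 0 < N.len := by
  have hr := N.mob.r_nonneg
  have hA := N.mob.A_pos
  have h1 := D.lo_pos N.j
  have h2 := D.M_ge
  have := N.len_pos_aux
  unfold len
  positivity

lemma e₁_sub_e₀ : N.e₁ - N.e₀ = N.σ * N.len := by
  have h1 := D.lo_pos N.j
  have h2 := D.M_ge
  rw [e₁, e₀, N.mob.apply_inv_sub (by positivity) (by positivity), len]
  congr 2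
  ring

lemma max_sub_min : max N.e₀ N.e₁ - min N.e₀ N.e₁ = N.len := by
  have h := N.e₁_sub_e₀
  have := N.len_pos
  rcases N.mob.sign with hs | hs <;> rw [hs] at h
  · rw [max_eq_right (by linarith), min_eq_left (by linarith)]; linarith
  · rw [max_eq_left (by linarith), min_eq_right (by linarith)]; linarith

lemma len_le : N.len ≤ 2 * (D.H + 1) / (1 + D.m - D.M) * N.gap := by
  have hr := N.mob.r_nonneg
  have hA := N.mob.A_pos
  have h1 := D.m_pos
  have h2 := D.M_ge
  have h3 := D.M_lt_one
  have h4 := D.lo_pos N.j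
  have h5 := N.len_pos_aux
  have h6 : (N.j : ℝ) + 1 ≤ N.t := by exact_mod_cast N.j_lt_t
  have h7 : (1 : ℝ) ≤ N.j := by exact_mod_cast N.one_le_j
  have h8 : (N.t : ℝ) ≤ D.H := by exact_mod_cast N.t_le
  have h9 : 0 < 1 + D.m - D.M := by linarith
  have h10 := D.m_le
  unfold len gap
  rw [div_mul_div_comm, mul_comm (2 * ((D.H : ℝ) + 1)), mul_div_mul_left _ _ h9.ne',
    div_le_div_iff₀ (by positivity) (by positivity)]
  have a1 : N.t + D.M - (N.j + D.lo N.j) ≤ D.H + 1 := by linarith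
  have a2 : N.j + 1 + D.m + N.r ≤ N.t + D.M + N.r := by linarith
  have a3 : N.j + D.M + N.r ≤ 2 * (N.j + D.lo N.j + N.r) := by linarith
  calc _ ≤ ((D.H : ℝ) + 1) * (N.A * (N.t + D.M + N.r) * (2 * (N.j + D.lo N.j + N.r))) := by
        gcongr
    _ = _ := by ring

lemma mem_pts_e₀ : N.e₀ ∈ N.pts := by
  have h1 := adm_altSeq D.one_le_h D.h_le
  have h2 := N.j_lt_t
  have h3 := N.one_le_j
  refine ⟨consSeq N.t (altSeq D.h), h1.consSeq (by omega) N.t_le (by omega), h2.le, le_rfl, ?_⟩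
  rw [cfVal_consSeq (by omega) h1.one_le, ← D.M_def, e₀]

lemma mem_pts_e₁ : N.e₁ ∈ N.pts := by
  have h1 := adm_altSeq D.one_le_h D.h_le
  have h2 := N.j_lt_t
  have h3 := N.one_le_j
  have h4 := D.three_le_top N.j
  have h5 : Adm D.h D.H (consSeq (D.top N.j) (altSeq D.h)) :=
    h1.consSeq (by omega) (D.top_le _) (by omega)
  refine ⟨consSeq N.j (consSeq (D.top N.j) (altSeq D.h)), h5.consSeq h3 (by have := N.t_le; omega)
    fun h => D.top_one_le h, le_rfl, h2.le, ?_⟩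
  rw [cfVal_consSeq h3 h5.one_le, cfVal_consSeq (by omega) h1.one_le, ← D.M_def, e₁, lo_eq]

end Node

end CantorData

lemma isCompact_setOf_adm (h H j t : ℕ) :
    IsCompact {u : ℕ → ℕ | Adm h H u ∧ j ≤ u 0 ∧ u 0 ≤ t} := by
  have hc : IsCompact (Set.pi univ fun _ : ℕ => Icc 1 H) :=
    isCompact_univ_pi fun _ => (Set.finite_Icc 1 H).isCompact
  refine hc.of_isClosed_subset ?_ fun u hu i _ => ⟨(hu.1 i).1, (hu.1 i).2.1⟩
  have h1 : {u : ℕ → ℕ | Adm h H u ∧ j ≤ u 0 ∧ u 0 ≤ t} =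
      (⋂ i, (fun u : ℕ → ℕ => (u i, u (i + 1))) ⁻¹'
        {p | 1 ≤ p.1 ∧ p.1 ≤ H ∧ (p.1 = 1 → p.2 ≤ h)}) ∩ (fun u : ℕ → ℕ => u 0) ⁻¹' Icc j t := by
    ext u
    simp [Adm]
  rw [h1]
  refine IsClosed.inter (isClosed_iInter fun i => ?_) ?_
  · exact (isClosed_discrete _).preimage (by fun_prop)
  · exact (isClosed_discrete _).preimage (by fun_prop)

namespace CantorData.Node

variable {D : CantorData} (N : D.Node)

lemma isCompact_pts : IsCompact N.pts := by
  have h : N.pts = (fun u => N.φ (cfVal u)) '' {u | Adm D.h D.H u ∧ N.j ≤ u 0 ∧ u 0 ≤ N.t} := by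
    ext x
    simp [pts, and_assoc]
  rw [h]
  refine (isCompact_setOf_adm _ _ _ _).image_of_continuousOn ?_
  refine N.mob.continuousOn.comp (continuousOn_cfVal.mono fun u hu => hu.1.one_le) fun u hu => ?_
  exact cfVal_nonneg u hu.1.one_le

lemma left_le : ∃ L, N.gap ≤ L ∧ N.φ (1 / (N.j + 1 + D.m)) - N.e₀ = N.σ * L := by
  have hr := N.mob.r_nonneg
  have hA := N.mob.A_pos
  have h1 := D.m_pos
  have h2 := D.M_ge
  have h3 := D.M_lt_one
  have h4 := D.m_le
  have h6 : (N.j : ℝ) + 1 ≤ N.t := by exact_mod_cast N.j_lt_t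
  have h7 : (1 : ℝ) ≤ N.j := by exact_mod_cast N.one_le_j
  refine ⟨_, ?_, N.mob.apply_inv_sub (by positivity) (by positivity)⟩
  have key : (1 + D.m - D.M) * (N.t + D.M + N.r) ≤
      (N.t + D.M - (N.j + 1 + D.m)) * (N.j + D.M + N.r) := by
    by_cases h : N.j + 1 = N.t
    · have h' : (N.t : ℝ) = N.j + 1 := by exact_mod_cast h.symm
      have := N.thick
      rw [h'] at this ⊢
      linarith
    · have h' : (N.j : ℝ) + 2 ≤ N.t := by
        exact_mod_cast (by have := N.j_lt_t; omega : N.j + 2 ≤ N.t)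
      have e : (N.t : ℝ) = N.j + 2 + (N.t - (N.j + 2)) := by ring
      have h8 : 0 ≤ (N.t : ℝ) - (N.j + 2) := by linarith
      nlinarith [mul_nonneg h8 (by linarith : 0 ≤ N.j + D.M + N.r - (1 + D.m - D.M)),
        mul_nonneg hr (by linarith : 0 ≤ 2 * D.M - 2 * D.m),
        mul_nonneg (by linarith : (0 : ℝ) ≤ N.j - 1) (by linarith : 0 ≤ 2 * D.M - 2 * D.m)]
  unfold gap
  rw [div_le_div_iff₀ (by positivity) (by positivity)]
  calc _ = (N.A * (N.j + 1 + D.m + N.r)) * ((1 + D.m - D.M) * (N.t + D.M + N.r)) := by ring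
    _ ≤ (N.A * (N.j + 1 + D.m + N.r)) *
        ((N.t + D.M - (N.j + 1 + D.m)) * (N.j + D.M + N.r)) := by gcongr
    _ = _ := by ring

lemma le_right : ∃ R, N.gap ≤ R ∧ N.e₁ - N.φ (1 / (N.j + D.M)) = N.σ * R := by
  have hr := N.mob.r_nonneg
  have hA := N.mob.A_pos
  have h1 := D.m_pos
  have h2 := D.M_ge
  have h3 := D.M_lt_one
  have h4 := D.m_le
  have h5 := D.lo_le N.j
  have h8 := D.lo_pos N.j
  have h9 := D.n_le
  have h7 : (1 : ℝ) ≤ N.j := by exact_mod_cast N.one_le_j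
  refine ⟨_, ?_, N.mob.apply_inv_sub (by positivity) (by positivity)⟩
  have key : (1 + D.m - D.M) * (N.j + D.lo N.j + N.r) ≤
      (N.j + D.M - (N.j + D.lo N.j)) * (N.j + 1 + D.m + N.r) := by
    have : N.j + D.M - (N.j + D.lo N.j) = D.M - D.lo N.j := by ring
    rw [this]
    exact mul_le_mul (by linarith) (by linarith) (by positivity) (by linarith)
  unfold gap
  rw [div_le_div_iff₀ (by positivity) (by positivity)]
  calc _ = (N.A * (N.j + D.M + N.r)) * ((1 + D.m - D.M) * (N.j + D.lo N.j + N.r)) := by ring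
    _ ≤ (N.A * (N.j + D.M + N.r)) *
        ((N.j + D.M - (N.j + D.lo N.j)) * (N.j + 1 + D.m + N.r)) := by gcongr
    _ = _ := by ring

lemma mid_eq : N.φ (1 / (N.j + D.M)) - N.φ (1 / (N.j + 1 + D.m)) = N.σ * N.gap := by
  have h1 := D.m_pos
  have h2 := D.M_ge
  have hr := N.mob.r_nonneg
  have hA := N.mob.A_pos
  have h7 : (1 : ℝ) ≤ N.j := by exact_mod_cast N.one_le_j
  rw [N.mob.apply_inv_sub (by positivity) (by positivity), gap]
  congr 1
  rw [div_eq_div_iff (by positivity) (by positivity)]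
  ring

lemma gap_le_len : N.gap ≤ N.len := by
  obtain ⟨L, hL, hL'⟩ := N.left_le
  obtain ⟨R, hR, hR'⟩ := N.le_right
  have h1 := N.mid_eq
  have h2 := N.e₁_sub_e₀
  have h3 := N.gap_pos
  rcases N.mob.sign with hs | hs <;> rw [hs] at hL' hR' h1 h2 <;> linarith

lemma exists_split : ∃ c d : D.Node, min c.e₀ c.e₁ = min N.e₀ N.e₁ ∧
    max d.e₀ d.e₁ = max N.e₀ N.e₁ ∧ min d.e₀ d.e₁ - max c.e₀ c.e₁ = N.gap ∧
    N.gap ≤ max c.e₀ c.e₁ - min c.e₀ c.e₁ ∧ N.gap ≤ max d.e₀ d.e₁ - min d.e₀ d.e₁ ∧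
    c.gap ≤ N.gap ∧ d.gap ≤ N.gap ∧ c.pts ⊆ N.pts ∧ d.pts ⊆ N.pts := by
  obtain ⟨L, hL, hL'⟩ := N.left_le
  obtain ⟨R, hR, hR'⟩ := N.le_right
  have hm := N.mid_eq
  have hg := N.gap_pos
  obtain ⟨c, hc, hcg, hcp⟩ := N.exists_left
  have hj := N.one_le_j
  have hdg := N.child_gap_le N.j hj le_rfl
  have hdp := N.child_pts_subset N.j hj le_rfl N.j_lt_t.le
  have hd1 : (N.child N.j hj).e₀ = N.e₁ := N.child_e₀ _ _
  have hd2 := N.child_e₁ N.j hj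
  rcases N.mob.sign with hs | hs <;> rw [hs] at hL' hR' hm
  · have hc1 : min c.e₀ c.e₁ = N.e₀ ∧ max c.e₀ c.e₁ = N.φ (1 / (N.j + 1 + D.m)) := by
      rcases hc with ⟨h1, h2⟩ | ⟨h1, h2⟩ <;> rw [h1, h2]
      · exact ⟨min_eq_left (by linarith), max_eq_right (by linarith)⟩
      · exact ⟨min_eq_right (by linarith), max_eq_left (by linarith)⟩
    refine ⟨c, N.child N.j hj, ?_, ?_, ?_, ?_, ?_, hcg, hdg, hcp, hdp⟩
    · rw [hc1.1, min_eq_left (by linarith)]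
    · rw [hd1, hd2, max_eq_left (by linarith), max_eq_right (by linarith)]
    · rw [hd1, hd2, hc1.2, min_eq_right (by linarith)]; linarith
    · rw [hc1.1, hc1.2]; linarith
    · rw [hd1, hd2, max_eq_left (by linarith), min_eq_right (by linarith)]; linarith
  · have hc1 : min c.e₀ c.e₁ = N.φ (1 / (N.j + 1 + D.m)) ∧ max c.e₀ c.e₁ = N.e₀ := by
      rcases hc with ⟨h1, h2⟩ | ⟨h1, h2⟩ <;> rw [h1, h2]
      · exact ⟨min_eq_right (by linarith), max_eq_left (by linarith)⟩
      · exact ⟨min_eq_left (by linarith), max_eq_right (by linarith)⟩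
    refine ⟨N.child N.j hj, c, ?_, ?_, ?_, ?_, ?_, hdg, hcg, hdp, hcp⟩
    · rw [hd1, hd2, min_eq_left (by linarith), min_eq_right (by linarith)]
    · rw [hc1.2, max_eq_left (by linarith)]
    · rw [hd1, hd2, hc1.1, max_eq_right (by linarith)]; linarith
    · rw [hd1, hd2, min_eq_left (by linarith), max_eq_right (by linarith)]; linarith
    · rw [hc1.1, hc1.2]; linarith

/-- The sum of the Cantor sets of two nodes of comparable size is an interval. -/
theorem exists_add_eq (a b : D.Node) (hab : a.gap ≤ b.len) (hba : b.gap ≤ a.len) (s : ℝ)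
    (hs : s ∈ Icc (min a.e₀ a.e₁ + min b.e₀ b.e₁) (max a.e₀ a.e₁ + max b.e₀ b.e₁)) :
    ∃ x ∈ a.pts, ∃ y ∈ b.pts, x + y = s := by
  have key := exists_abs_add_sub_le_of_split (fun N : D.Node => min N.e₀ N.e₁)
    (fun N => max N.e₀ N.e₁) gap pts (2 * (D.H + 1) / (1 + D.m - D.M))
    (fun N => by
      rcases min_choice N.e₀ N.e₁ with h | h <;> simp only [h]
      exacts [N.mem_pts_e₀, N.mem_pts_e₁])
    gap_pos (fun N => min_le_max) (fun N => N.max_sub_min.le.trans N.len_le)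
    exists_split a b (by simpa only [max_sub_min]) (by simpa only [max_sub_min]) s hs
  have hcl : IsClosed (a.pts + b.pts) := (a.isCompact_pts.add b.isCompact_pts).isClosed
  have hmem : s ∈ closure (a.pts + b.pts) := by
    rw [Metric.mem_closure_iff]
    intro ε hε
    obtain ⟨x, hx, y, hy, h⟩ := key (ε / 2) (by positivity)
    refine ⟨x + y, Set.add_mem_add hx hy, ?_⟩
    rw [dist_comm, Real.dist_eq]
    linarith
  rw [hcl.closure_eq] at hmem
  obtain ⟨x, hx, y, hy, h⟩ := hmem
  exact ⟨x, hx, y, hy, h⟩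

end CantorData.Node

/-- The effect on values of prefixing the partial quotients `1, k`. -/
def tmap (k : ℕ) (w : ℝ) : ℝ := 1 / (1 + 1 / (k + w))

lemma tmap_eq {k : ℕ} {w : ℝ} (hk : 1 ≤ k) (hw : 0 ≤ w) : tmap k w = 1 - 1 / (k + 1 + w) := by
  have hk' : (1 : ℝ) ≤ k := by exact_mod_cast hk
  unfold tmap
  have h1 : (k : ℝ) + w ≠ 0 := by positivity
  have h2 : (k : ℝ) + 1 + w ≠ 0 := by positivity
  have h3 : (k : ℝ) + w + 1 ≠ 0 := by positivity
  field_simp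
  ring

lemma tmap_nonneg {k : ℕ} {w : ℝ} (hw : 0 ≤ w) : 0 ≤ tmap k w := by
  unfold tmap
  positivity

lemma iterate_tmap_nonneg {k : ℕ} {w : ℝ} (hw : 0 ≤ w) (p : ℕ) : 0 ≤ (tmap k)^[p] w := by
  induction p generalizing w with
  | zero => exact hw
  | succ p ih => exact ih (tmap_nonneg hw)

lemma tmap_mono {k : ℕ} (hk : 1 ≤ k) {x y : ℝ} (hx : 0 ≤ x) (hxy : x ≤ y) :
    tmap k x ≤ tmap k y := by
  have hk' : (1 : ℝ) ≤ k := by exact_mod_cast hk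
  unfold tmap
  have hy := hx.trans hxy
  gcongr

lemma iterate_tmap_mono {k : ℕ} (hk : 1 ≤ k) {x y : ℝ} (hx : 0 ≤ x) (hxy : x ≤ y) (p : ℕ) :
    (tmap k)^[p] x ≤ (tmap k)^[p] y := by
  induction p generalizing x y with
  | zero => exact hxy
  | succ p ih => exact ih (tmap_nonneg hx) (tmap_mono hk hx hxy)

lemma abs_iterate_tmap_sub_le {k : ℕ} (hk : 1 ≤ k) {x y : ℝ} (hx : 0 ≤ x) (hy : 0 ≤ y) (p : ℕ) :
    |(tmap k)^[p] x - (tmap k)^[p] y| ≤ (1 / 4) ^ p * |x - y| := by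
  induction p generalizing x y with
  | zero => simp
  | succ p ih =>
    have hk' : (1 : ℝ) ≤ k := by exact_mod_cast hk
    rw [Function.iterate_succ_apply, Function.iterate_succ_apply]
    refine (ih (tmap_nonneg hx) (tmap_nonneg hy)).trans ?_
    have h1 : |tmap k x - tmap k y| ≤ |x - y| / 4 := abs_two_step_sub_le le_rfl hk' hx hy
    calc (1 / 4 : ℝ) ^ p * |tmap k x - tmap k y| ≤ (1 / 4) ^ p * (|x - y| / 4) := by gcongr
      _ = _ := by ring

lemma tendsto_iterate_tmap {k : ℕ} (hk : 1 ≤ k) {x a : ℝ} (hx : 0 ≤ x) (ha : 0 ≤ a)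
    (hfix : tmap k a = a) : Tendsto (fun p => (tmap k)^[p] x) atTop (nhds a) := by
  rw [tendsto_iff_dist_tendsto_zero]
  refine squeeze_zero (fun _ => dist_nonneg) (fun p => ?_) (g := fun p => (1 / 4) ^ p * |x - a|) ?_
  · rw [Real.dist_eq]
    have := abs_iterate_tmap_sub_le hk hx ha p
    rwa [Function.iterate_fixed hfix p] at this
  · have := (tendsto_pow_atTop_nhds_zero_of_lt_one (by norm_num : (0 : ℝ) ≤ 1 / 4)
      (by norm_num)).mul_const |x - a|
    simpa using this

lemma exists_isMob_iterate_tmap {k : ℕ} (hk : 1 ≤ k) (p : ℕ) :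
    ∃ A r : ℝ, r * k ≤ 1 ∧ IsMob (tmap k)^[p] A r 1 := by
  have hk' : (1 : ℝ) ≤ k := by exact_mod_cast hk
  induction p with
  | zero => exact ⟨1, 0, by simp, by simpa using IsMob.id_isMob⟩
  | succ p ih =>
    obtain ⟨A, r, -, h⟩ := ih
    have h1 := (h.comp_inv (d := 1) one_pos).comp_inv (d := k) (by positivity)
    have hr := h.r_nonneg
    refine ⟨_, 1 / (k + 1 / (1 + r)), ?_, by rw [neg_neg] at h1; exact h1⟩
    rw [div_mul_eq_mul_div, div_le_one (by positivity)]
    have : 0 ≤ 1 / (1 + r) := by positivity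
    linarith

/-- The numerical inequalities which make the sums of the Cantor sets appearing in
`exists_iterate_add_eq` cover an interval. -/
structure CoverData extends CantorData where
  diff_ge : 0.5824 ≤ M - m
  left_cond : (h + 1) * (m + 1 + 1 / (1 + M) - 2 * M) + 2 * m * (1 + 1 / (1 + M)) -
    M * (m + 1 + 1 / (1 + M)) ≤ 0
  right_cond : (1 + m - M) * ((h + 2) * (h + 2 + 1 / (1 + 1 / (h - 1 + M))) - 1) ≤
    (1 / (1 + 1 / (h - 1 + M)) - m) * (h + 1 + M) ^ 2
  gap_cond : (1 / (1 + M) - 1 / (2 + m)) * ((h + 2) * (h + 2 + 1 / (1 + M)) - 1) *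
      ((h + 2) * (h + 2 + 1 / (1 + 1 / (h - 1 + M))) - 1) ≤
    (1 / (1 + 1 / (h - 1 + M)) - 1 / (1 + M)) * ((h + 2) * (h + 1 + 1 / (2 + m)) - 1) *
      ((h + 2) * (h + 1 + 1 / (1 + M)) - 1)

lemma exists_coverData_four : ∃ D : CoverData, D.h + 1 = 4 ∧ D.H ≤ 4 := by
  set M := cfVal (altSeq 3) with hM
  have hM0 : 0 < M := cfVal_pos _ (one_le_altSeq (by norm_num))
  have hq : M ^ 2 + 3 * M = 3 := by
    have := cfVal_altSeq (h := 3) (by norm_num)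
    rw [← hM] at this
    push_cast at this
    field_simp at this
    linarith
  have hl : 0.791287 ≤ M := by nlinarith
  have hu : M ≤ 0.791288 := by nlinarith
  have hm : 1 / (4 + M) = 1 - M := by
    rw [div_eq_iff (by positivity)]; linarith
  have hn : 1 / (3 + M) ≤ 0.264 := by
    rw [div_le_iff₀ (by positivity)]; linarith
  have hv0 : 1 / (1 + M) = (2 + M) / 5 := by
    rw [div_eq_iff (by positivity)]; linarith
  have hv1 : 1 / (1 + 1 / (((3 : ℕ) : ℝ) - 1 + M)) = 1 - M / 3 := by
    have h2 : (((3 : ℕ) : ℝ) - 1 + M) = 2 + M := by push_cast; ring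
    rw [h2]
    field_simp
    nlinarith
  have hu1 : 1 / (2 + (1 - M)) = (M + 6) / 15 := by
    rw [div_eq_iff (by linarith)]
    linarith
  refine ⟨{ h := 3, H := 4, M := M, m := 1 - M, n := 1 / (3 + M), three_le := le_rfl,
            h_le := by norm_num, M_def := hM, n_def := by norm_num, m_def := by push_cast; exact hm.symm,
            M_ge := by linarith, n_le := hn, m_le := by linarith, diff_ge := by linarith,
            left_cond := ?_, right_cond := ?_, gap_cond := ?_ }, rfl, le_rfl⟩
  · rw [hv0]
    push_cast
    nlinarith
  · rw [hv1]
    push_cast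
    nlinarith
  · rw [hv1, hv0, hu1]
    push_cast
    have e1 : 0 ≤ (2 + M) / 5 - (M + 6) / 15 := by linarith
    have e2 : (2 + M) / 5 - (M + 6) / 15 ≤ 0.1056 := by linarith
    have e3 : (3 + 2) * (3 + 2 + (2 + M) / 5) - 1 ≤ 26.8 := by linarith
    have e4 : (3 + 2) * (3 + 2 + (1 - M / 3)) - 1 ≤ 27.7 := by linarith
    have e5 : 0.1779 ≤ 1 - M / 3 - (2 + M) / 5 := by linarith
    have e6 : 21.26 ≤ (3 + 2) * (3 + 1 + (M + 6) / 15) - 1 := by linarith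
    have e7 : 21.79 ≤ (3 + 2) * (3 + 1 + (2 + M) / 5) - 1 := by linarith
    calc _ ≤ (0.1056 * 26.8 * 27.7 : ℝ) := by gcongr <;> linarith
      _ ≤ 0.1779 * 21.26 * 21.79 := by norm_num
      _ ≤ _ := by gcongr

lemma exists_coverData_of_four_le {h : ℕ} (hh : 4 ≤ h) : ∃ D : CoverData, D.h = h ∧ D.H = h := by
  set M := cfVal (altSeq h) with hM
  have hM0 : 0 < M := cfVal_pos _ (one_le_altSeq (by omega))
  have hh' : (4 : ℝ) ≤ h := by exact_mod_cast hh
  have hq : M ^ 2 + h * M = h := by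
    have := cfVal_altSeq (h := h) (by omega)
    rw [← hM] at this
    field_simp at this
    linarith
  have hu : M ≤ 1 := by nlinarith
  have hl : 0.828 ≤ M := by nlinarith
  set m := 1 / (h + M) with hm
  have hm0 : 0 < m := by positivity
  have hmM : m * (h + M) = 1 := by rw [hm]; field_simp
  have hm1 : m ≤ 0.2072 := by nlinarith
  have a1 : 1 / (1 + M) ≤ 0.5471 := by rw [div_le_iff₀ (by positivity)]; linarith
  have a2 : 0.5 ≤ 1 / (1 + M) := by rw [le_div_iff₀ (by positivity)]; linarith
  have a3 : 0.792 ≤ 1 / (1 + 1 / (h - 1 + M)) := by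
    have : 1 / (h - 1 + M) ≤ 0.2613 := by rw [div_le_iff₀ (by linarith)]; linarith
    have h0 : 0 ≤ 1 / (h - 1 + M) := one_div_nonneg.2 (by linarith)
    rw [le_div_iff₀ (by positivity)]
    linarith
  have a4 : 1 / (1 + 1 / (h - 1 + M)) ≤ 1 := by
    have h0 : 0 ≤ 1 / (h - 1 + M) := one_div_nonneg.2 (by linarith)
    rw [div_le_iff₀ (by positivity)]
    linarith
  have a5 : 0.453 ≤ 1 / (2 + m) := by rw [le_div_iff₀ (by positivity)]; linarith
  have a6 : 1 / (2 + m) ≤ 0.5 := by rw [div_le_iff₀ (by positivity)]; linarith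
  refine ⟨{ h := h, H := h, M := M, m := m, n := m, three_le := by omega,
            h_le := le_rfl, M_def := hM, n_def := hm, m_def := hm,
            M_ge := by linarith, n_le := by linarith, m_le := by linarith, diff_ge := by linarith,
            left_cond := ?_, right_cond := ?_, gap_cond := ?_ }, rfl, rfl⟩
  · generalize 1 / (1 + M) = v at *
    nlinarith
  · generalize 1 / (1 + 1 / ((h : ℝ) - 1 + M)) = v at *
    calc _ ≤ 0.3792 * (((h : ℝ) + 2) * (h + 2 + 1) - 1) := by gcongr; nlinarith; linarith
      _ ≤ 0.5848 * (h + 1 + 0.828) ^ 2 := by nlinarith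
      _ ≤ _ := by gcongr <;> linarith
  · generalize 1 / (1 + 1 / ((h : ℝ) - 1 + M)) = v at *
    generalize 1 / (1 + M) = v' at *
    generalize 1 / (2 + m) = w at *
    calc _ ≤ 0.0941 * (((h : ℝ) + 2) * (h + 2 + 1) - 1) * ((h + 2) * (h + 2 + 1) - 1) := by
          gcongr <;> first | linarith | nlinarith
      _ ≤ 0.2449 * ((h + 2) * (h + 1 + 0.4) - 1) * ((h + 2) * (h + 1 + 0.4) - 1) := by
          have h1 : 0 ≤ ((h : ℝ) + 2) * (h + 2 + 1) - 1 := by nlinarith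
          have h2 : ((h : ℝ) + 2) * (h + 2 + 1) - 1 ≤ 1.6 * ((h + 2) * (h + 1 + 0.4) - 1) := by
            nlinarith
          nlinarith [mul_le_mul h2 h2 h1 (h1.trans h2)]
      _ ≤ _ := by
          have : 0 ≤ ((h : ℝ) + 2) * (h + 1 + 0.4) - 1 := by nlinarith
          have h1 : ((h : ℝ) + 2) * (h + 1 + 0.4) - 1 ≤ (h + 2) * (h + 1 + w) - 1 := by
            gcongr; linarith
          have h2 : ((h : ℝ) + 2) * (h + 1 + 0.4) - 1 ≤ (h + 2) * (h + 1 + v') - 1 := by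
            gcongr; linarith
          refine mul_le_mul (mul_le_mul (by linarith) h1 this (by linarith)) h2 this ?_
          exact mul_nonneg (by linarith) (this.trans h1)

namespace IsMob

variable {φ : ℝ → ℝ} {A r : ℝ} {a b c d : ℝ}

lemma add_le_two_mul (hφ : IsMob φ A r 1) (ha : 0 ≤ a) (hac : a ≤ c) (hab : a ≤ b)
    (h : a + b ≤ 2 * c) : φ a + φ b ≤ 2 * φ c := by
  have hA := hφ.A_pos
  have hr := hφ.r_nonneg
  have hb := ha.trans hab
  have hc := ha.trans hac
  have h1 := hφ.sub_eq b c hb hc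
  have h2 := hφ.sub_eq c a hc ha
  have key : 1 * (b - c) / (A * (1 + r * b) * (1 + r * c)) ≤
      1 * (c - a) / (A * (1 + r * c) * (1 + r * a)) := by
    calc 1 * (b - c) / (A * (1 + r * b) * (1 + r * c))
        ≤ 1 * (c - a) / (A * (1 + r * b) * (1 + r * c)) :=
          div_le_div_of_nonneg_right (by linarith) (by positivity)
      _ ≤ 1 * (c - a) / (A * (1 + r * a) * (1 + r * c)) := by
          have := sub_nonneg.2 hac
          gcongr
      _ = _ := by rw [mul_right_comm]
  linarith

lemma two_mul_le_add {k : ℝ} (hφ : IsMob φ A r 1) (hrk : r * k ≤ 1) (hk : 0 < k) (ha : 0 ≤ a)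
    (hab : a ≤ b) (hbc : b ≤ c) (h : (b - a) * (k + c) ≤ (c - b) * (k + a)) :
    2 * φ b ≤ φ a + φ c := by
  have hA := hφ.A_pos
  have hr := hφ.r_nonneg
  have hb := ha.trans hab
  have hc := hb.trans hbc
  have h1 := hφ.sub_eq b a hb ha
  have h2 := hφ.sub_eq c b hc hb
  have h0 : b - a ≤ c - b := by nlinarith
  have h3 : (b - a) * (1 + r * c) ≤ (c - b) * (1 + r * a) := by
    nlinarith [mul_nonneg (sub_nonneg.2 hrk) (sub_nonneg.2 h0), mul_nonneg hr (sub_nonneg.2 h)]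
  have key : 1 * (b - a) / (A * (1 + r * b) * (1 + r * a)) ≤
      1 * (c - b) / (A * (1 + r * c) * (1 + r * b)) := by
    rw [div_le_div_iff₀ (by positivity) (by positivity)]
    have := mul_le_mul_of_nonneg_left h3 (by positivity : 0 ≤ A * (1 + r * b))
    linarith
  linarith

lemma sub_le_sub_of_mul_le {k : ℝ} (hφ : IsMob φ A r 1) (hrk : r * k ≤ 1) (hk : 0 < k)
    (ha : 0 ≤ a) (hab : a ≤ b) (hac : a ≤ c) (hbd : b ≤ d)
    (h : (b - a) * (k + c) * (k + d) ≤ (d - c) * (k + a) * (k + b)) :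
    φ b - φ a ≤ φ d - φ c := by
  have hA := hφ.A_pos
  have hr := hφ.r_nonneg
  have hb := ha.trans hab
  have hc := ha.trans hac
  have hd := hb.trans hbd
  rw [hφ.sub_eq b a hb ha, hφ.sub_eq d c hd hc, div_le_div_iff₀ (by positivity) (by positivity)]
  have h1 : (1 + r * c) * (k + a) ≤ (k + c) * (1 + r * a) := by
    nlinarith [mul_nonneg (sub_nonneg.2 hrk) (sub_nonneg.2 hac)]
  have h2 : (1 + r * d) * (k + b) ≤ (k + d) * (1 + r * b) := by
    nlinarith [mul_nonneg (sub_nonneg.2 hrk) (sub_nonneg.2 hbd)]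
  have h3 : (b - a) * (1 + r * c) * (1 + r * d) ≤ (d - c) * (1 + r * a) * (1 + r * b) := by
    refine le_of_mul_le_mul_right ?_ (by positivity : 0 < (k + a) * (k + b))
    calc (b - a) * (1 + r * c) * (1 + r * d) * ((k + a) * (k + b))
        = (b - a) * (((1 + r * c) * (k + a)) * ((1 + r * d) * (k + b))) := by ring
      _ ≤ (b - a) * (((k + c) * (1 + r * a)) * ((k + d) * (1 + r * b))) := by
          have := sub_nonneg.2 hab
          gcongr
      _ = (b - a) * (k + c) * (k + d) * ((1 + r * a) * (1 + r * b)) := by ring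
      _ ≤ (d - c) * (k + a) * (k + b) * ((1 + r * a) * (1 + r * b)) := by gcongr
      _ = _ := by ring
  have := mul_le_mul_of_nonneg_left h3 hA.le
  linarith

lemma sub_le_sub_of_le (hφ : IsMob φ A r 1) (hc : 0 ≤ c) (hab : a ≤ b) (hca : c ≤ a)
    (hdb : d ≤ b) (hd : 0 ≤ d) (h : b - a ≤ d - c) : φ b - φ a ≤ φ d - φ c := by
  have hA := hφ.A_pos
  have hr := hφ.r_nonneg
  have ha := hc.trans hca
  have hb := ha.trans hab
  rw [hφ.sub_eq b a hb ha, hφ.sub_eq d c hd hc]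
  have := sub_nonneg.2 hab
  gcongr
  linarith

end IsMob

namespace CoverData

open CantorData

variable (D : CoverData)

lemma M_eq_sub : D.M = 1 - 1 / (D.h + 1 + D.M) := by
  have := D.M_ge
  have h := D.M_eq
  rw [D.n_def] at h
  conv_lhs => rw [h]
  field_simp
  ring

section

variable {D} {F : ℝ → ℝ} {A r : ℝ} (hF : IsMob F A r 1) (hr : r * (D.h + 1) ≤ 1)

lemma tmap_succ_eq {w : ℝ} (hw : 0 ≤ w) : tmap (D.h + 1) w = 1 - 1 / (D.h + 2 + w) := by
  rw [tmap_eq (by omega) hw]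
  push_cast
  ring

lemma one_sub_sub {x y : ℝ} (hx : 0 < x) (hy : 0 < y) :
    (1 - 1 / x) - (1 - 1 / y) = (x - y) / (x * y) := by
  field_simp
  ring

lemma one_sub_le_one_sub {x y : ℝ} (hx : 0 < x) (hxy : x ≤ y) : 1 - 1 / x ≤ 1 - 1 / y :=
  sub_le_sub_left (one_div_le_one_div_of_le hx hxy) 1

variable (D) in
lemma le_child_top : 0.7 ≤ 1 / (1 + 1 / (D.h - 1 + D.M)) := by
  have h3 : (3 : ℝ) ≤ D.h := by exact_mod_cast D.three_le
  have hM := D.M_ge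
  have h1 : 1 / (D.h - 1 + D.M) ≤ 0.4 := by rw [div_le_iff₀ (by linarith)]; linarith
  have h0 : 0 ≤ 1 / (D.h - 1 + D.M) := one_div_nonneg.2 (by linarith)
  rw [le_div_iff₀ (by positivity)]
  linarith

include hF in
lemma left_ineq :
    F (tmap D.h D.m) + F (tmap (D.h + 1) (1 / (1 + D.M))) ≤ 2 * F D.M := by
  have h3 : (3 : ℝ) ≤ D.h := by exact_mod_cast D.three_le
  have hm0 := D.m_pos
  have hM := D.M_ge
  have hd := D.diff_ge
  have hm := D.m_le
  have hc := D.left_cond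
  have hv : 0 < 1 / (1 + D.M) := by positivity
  have e : D.M = 1 - 1 / (D.h + 1 + D.M) := D.M_eq_sub
  have hw := tmap_eq D.one_le_h hm0.le
  have hx := tmap_succ_eq (D := D) hv.le
  refine hF.add_le_two_mul (tmap_nonneg hm0.le) ?_ ?_ ?_
  · rw [hw, e]
    exact one_sub_le_one_sub (by positivity) (by linarith)
  · rw [hw, hx]
    exact one_sub_le_one_sub (by positivity) (by linarith)
  · rw [hw, hx]
    generalize 1 / (1 + D.M) = v at *
    have key : 2 * (1 / (D.h + 1 + D.M)) ≤ 1 / (D.h + 1 + D.m) + 1 / (D.h + 2 + v) := by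
      rw [div_add_div _ _ (by positivity) (by positivity), mul_one_div,
        div_le_div_iff₀ (by positivity) (by positivity)]
      nlinarith
    linarith

include hF hr in
lemma right_ineq : 2 * F (tmap (D.h + 1) D.m) ≤
    F D.M + F (tmap (D.h + 1) (1 / (1 + 1 / (D.h - 1 + D.M)))) := by
  have h3 : (3 : ℝ) ≤ D.h := by exact_mod_cast D.three_le
  have hm0 := D.m_pos
  have hM := D.M_ge
  have hM1 := D.M_lt_one
  have hd := D.diff_ge
  have hm := D.m_le
  have hc := D.right_cond
  have hv := D.le_child_top
  have e : D.M = 1 - 1 / (D.h + 1 + D.M) := D.M_eq_sub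
  generalize 1 / (1 + 1 / (D.h - 1 + D.M)) = v at *
  have hw := tmap_succ_eq (D := D) hm0.le
  have hx := tmap_succ_eq (D := D) (by linarith : 0 ≤ v)
  refine hF.two_mul_le_add hr (by positivity) (by linarith) ?_ ?_ ?_
  · rw [hw, e]
    exact one_sub_le_one_sub (by positivity) (by linarith)
  · rw [hw, hx]
    exact one_sub_le_one_sub (by positivity) (by linarith)
  · have h1 : tmap (D.h + 1) D.m - D.M =
        (D.h + 2 + D.m - (D.h + 1 + D.M)) / ((D.h + 2 + D.m) * (D.h + 1 + D.M)) := by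
      rw [← one_sub_sub (by positivity) (by positivity), ← e, hw]
    rw [h1, hx, hw, one_sub_sub (by positivity) (by positivity)]
    have h2 : D.h + 1 + (1 - 1 / (D.h + 2 + v)) =
        ((D.h + 2) * (D.h + 2 + v) - 1) / (D.h + 2 + v) := by field_simp; ring
    rw [h2, div_mul_div_comm, div_mul_eq_mul_div, div_le_div_iff₀ (by positivity) (by positivity)]
    have := mul_le_mul_of_nonneg_left hc
      (by positivity : 0 ≤ (D.h + 2 + D.m) * (D.h + 2 + v))
    convert this using 1 <;> ring

include hF hr in
lemma gap_ineq : F (tmap D.h (1 / (1 + D.M))) - F (tmap D.h (1 / (2 + D.m))) ≤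
    F (tmap (D.h + 1) (1 / (1 + 1 / (D.h - 1 + D.M)))) - F (tmap (D.h + 1) (1 / (1 + D.M))) := by
  have h3 : (3 : ℝ) ≤ D.h := by exact_mod_cast D.three_le
  have hm0 := D.m_pos
  have hM := D.M_ge
  have hM1 := D.M_lt_one
  have hd := D.diff_ge
  have hm := D.m_le
  have hc := D.gap_cond
  have hv1 := D.le_child_top
  have hu : 0 ≤ 1 / (2 + D.m) := by positivity
  have hv0 : 0 ≤ 1 / (1 + D.M) := by positivity
  have huv : 1 / (2 + D.m) ≤ 1 / (1 + D.M) :=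
    one_div_le_one_div_of_le (by positivity) (by linarith)
  have hv01 : 1 / (1 + D.M) ≤ 0.6 := by rw [div_le_iff₀ (by positivity)]; linarith
  generalize 1 / (1 + 1 / (D.h - 1 + D.M)) = v₁ at *
  generalize 1 / (1 + D.M) = v₀ at *
  generalize 1 / (2 + D.m) = u at *
  have eu := tmap_eq D.one_le_h hu
  have ev := tmap_eq D.one_le_h hv0
  have e0 := tmap_succ_eq (D := D) hv0
  have e1 := tmap_succ_eq (D := D) (by linarith : 0 ≤ v₁)
  refine hF.sub_le_sub_of_mul_le hr (by positivity) (tmap_nonneg hu) ?_ ?_ ?_ ?_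
  · exact tmap_mono D.one_le_h hu huv
  · rw [eu, e0]
    exact one_sub_le_one_sub (by positivity) (by linarith)
  · rw [ev, e1]
    exact one_sub_le_one_sub (by positivity) (by linarith)
  · rw [eu, ev, e0, e1, one_sub_sub (by positivity) (by positivity),
      one_sub_sub (by positivity) (by positivity)]
    have h2 : ∀ x : ℝ, 0 < x → D.h + 1 + (1 - 1 / x) = ((D.h + 2) * x - 1) / x := by
      intro x hx
      field_simp
      ring
    rw [h2 _ (by positivity), h2 _ (by positivity), h2 _ (by positivity), h2 _ (by positivity),
      div_mul_div_comm, div_mul_div_comm, div_mul_div_comm, div_mul_div_comm,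
      div_le_div_iff₀ (by positivity) (by positivity)]
    have := mul_le_mul_of_nonneg_left hc
      (by positivity : 0 ≤ (D.h + 2 + v₀) * (D.h + 2 + v₁) * (D.h + 1 + u) * (D.h + 1 + v₀))
    convert this using 1 <;> ring

include hF in
lemma gap_ineq' : F (tmap (D.h + 1) (1 / (1 + 1 / (2 + D.m)))) -
    F (tmap (D.h + 1) (1 / (1 + 1 / (1 + D.M)))) ≤ F D.M - F (tmap D.h D.m) := by
  have h3 : (3 : ℝ) ≤ D.h := by exact_mod_cast D.three_le
  have hm0 := D.m_pos
  have hM := D.M_ge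
  have hM1 := D.M_lt_one
  have hd := D.diff_ge
  have hm := D.m_le
  have e : D.M = 1 - 1 / (D.h + 1 + D.M) := D.M_eq_sub
  have ew := tmap_eq D.one_le_h hm0.le
  have hb1 : 0 ≤ 1 / (1 + 1 / (1 + D.M)) := by positivity
  have hb2 : 0 ≤ 1 / (1 + 1 / (2 + D.m)) := by positivity
  have hb : 1 / (1 + 1 / (1 + D.M)) ≤ 1 / (1 + 1 / (2 + D.m)) := by
    have : 1 / (2 + D.m) ≤ 1 / (1 + D.M) :=
      one_div_le_one_div_of_le (by positivity) (by linarith)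
    gcongr
  have hbb : 1 / (1 + 1 / (2 + D.m)) - 1 / (1 + 1 / (1 + D.M)) ≤ D.M - D.m := by
    have h1 : 1 / (1 + 1 / (2 + D.m)) ≤ 1 := by
      rw [div_le_one (by positivity)]
      linarith [show 0 ≤ 1 / (2 + D.m) by positivity]
    have h2 : 0.6 ≤ 1 / (1 + 1 / (1 + D.M)) := by
      have : 1 / (1 + D.M) ≤ 0.6 := by rw [div_le_iff₀ (by positivity)]; linarith
      rw [le_div_iff₀ (by positivity)]
      linarith
    linarith
  generalize 1 / (1 + 1 / (1 + D.M)) = b₁ at *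
  generalize 1 / (1 + 1 / (2 + D.m)) = b₂ at *
  have e1 := tmap_succ_eq (D := D) hb1
  have e2 := tmap_succ_eq (D := D) hb2
  refine hF.sub_le_sub_of_le (tmap_nonneg hm0.le) ?_ ?_ ?_ (by linarith) ?_
  · exact tmap_mono (by omega) hb1 hb
  · rw [ew, e1]
    exact one_sub_le_one_sub (by positivity) (by linarith)
  · rw [e2, e]
    exact one_sub_le_one_sub (by positivity) (by linarith)
  · have h1 : D.M - tmap D.h D.m =
        (D.h + 1 + D.M - (D.h + 1 + D.m)) / ((D.h + 1 + D.M) * (D.h + 1 + D.m)) := by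
      rw [← one_sub_sub (by positivity) (by positivity), ← e, ew]
    rw [h1, e1, e2, one_sub_sub (by positivity) (by positivity)]
    refine div_le_div₀ (by linarith) (by linarith) (by positivity) ?_
    exact mul_le_mul (by linarith) (by linarith) (by positivity) (by positivity)

end

/-- The node of all admissible sequences, preceded by `p` copies of `1, h + 1`. -/
lemma exists_root (p : ℕ) : ∃ N : D.Node, N.φ = (tmap (D.h + 1))^[p] ∧ N.r * (D.h + 1) ≤ 1 ∧
    N.σ = 1 ∧ N.j = 1 ∧ N.t = D.H := by
  obtain ⟨A, r, hr, hmob⟩ := exists_isMob_iterate_tmap (k := D.h + 1) (by omega) p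
  have h3 := D.three_le
  have hH := D.h_le
  exact ⟨⟨_, A, r, 1, 1, D.H, hmob, le_rfl, by omega, le_rfl,
    D.thick_of_three_le (h3.trans hH) hmob.r_nonneg⟩, rfl, by exact_mod_cast hr, rfl, rfl, rfl⟩

lemma exists_add_eq_of_le (p : ℕ) (s : ℝ) (h1 : 2 * (tmap (D.h + 1))^[p] D.m ≤ s)
    (h2 : s ≤ 2 * (tmap (D.h + 1))^[p] D.M) :
    ∃ U V, Adm D.h D.H U ∧ Adm D.h D.H V ∧
      s = (tmap (D.h + 1))^[p] (cfVal U) + (tmap (D.h + 1))^[p] (cfVal V) := by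
  obtain ⟨N, hφ, -, hσ, hj, ht⟩ := D.exists_root p
  have e0 : N.e₀ = (tmap (D.h + 1))^[p] D.m := by rw [Node.e₀, hφ, ht, D.m_def]
  have e1 : N.e₁ = (tmap (D.h + 1))^[p] D.M := by
    rw [Node.e₁, hφ, hj, D.M_eq]; simp [lo]
  obtain ⟨x, ⟨U, hU, -, -, rfl⟩, y, ⟨V, hV, -, -, rfl⟩, h⟩ := N.exists_add_eq N N.gap_le_len N.gap_le_len s
    ⟨by rw [← e0] at h1; linarith [min_le_left N.e₀ N.e₁],
      by rw [← e1] at h2; linarith [le_max_right N.e₀ N.e₁]⟩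
  exact ⟨U, V, hU, hV, by rw [← h, hφ]⟩

lemma exists_add_eq_of_ge (p : ℕ) (s : ℝ) (h1 : 2 * (tmap (D.h + 1))^[p] D.M ≤ s)
    (h2 : s ≤ 2 * (tmap (D.h + 1))^[p + 1] D.m) :
    ∃ U V, Adm D.h D.H U ∧ Adm D.h D.H V ∧ cfVal V ≤ cfVal U ∧
      s = (tmap (D.h + 1))^[p] (cfVal U) + (tmap (D.h + 1))^[p + 1] (cfVal V) := by
  obtain ⟨N, hφ, hr, hσ, hj, ht⟩ := D.exists_root p
  obtain ⟨N', hφ', hr', hσ', -, -⟩ := D.exists_root (p + 1)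
  have h3 := D.three_le
  have h3' : (3 : ℝ) ≤ D.h := by exact_mod_cast h3
  have hhH := D.h_le
  have hm0 := D.m_pos
  have hMg := D.M_ge
  have hM1 := D.M_lt_one
  have hd := D.diff_ge
  have hmle := D.m_le
  have hN'r := N'.mob.r_nonneg
  have hcast : ((D.h - 1 : ℕ) : ℝ) = D.h - 1 := by rw [Nat.cast_sub (by omega)]; simp
  let W := (N.child 1 le_rfl).child D.h D.one_le_h
  let V : D.Node := { N'.child 1 le_rfl with
    t := D.h - 1
    j_lt_t := by show 1 < D.h - 1; omega
    t_le := by omega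
    thick := by
      show (1 + D.m - D.M) * ((D.h - 1 : ℕ) + D.M + 1 / ((1 : ℕ) + N'.r)) ≤
        (D.M - D.m) * ((D.h - 1 : ℕ) - 1 + D.M + 1 / ((1 : ℕ) + N'.r))
      have : 0.8 ≤ 1 / (((1 : ℕ) : ℝ) + N'.r) := by
        rw [le_div_iff₀ (by positivity)]
        push_cast
        nlinarith
      rw [hcast]
      nlinarith [mul_nonneg (sub_nonneg.2 hd) (by linarith : 0 ≤ D.h - 1 - 1 + D.M + 1 / (((1 : ℕ) : ℝ) + N'.r))] }
  have hmob := N.mob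
  rw [hφ, hσ] at hmob
  have hWφ : ∀ u, W.φ u = (tmap (D.h + 1))^[p] (tmap D.h u) := fun u => by
    simp [W, Node.child, hφ, tmap]
  have hVφ : ∀ u, V.φ u = (tmap (D.h + 1))^[p] (tmap (D.h + 1) (1 / (1 + u))) := fun u => by
    simp [V, Node.child, hφ']
  have hWσ : W.σ = 1 := by simp [W, Node.child, hσ]
  have hVσ : V.σ = -1 := by simp [V, Node.child, hσ']
  have hlo : D.lo D.h = D.m := by simp only [lo]; rw [if_neg (by omega)]
  have hlo1 : 1 / (1 + D.lo 1) = D.M := by rw [D.M_eq]; simp [lo]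
  have hMh : tmap D.h D.M = D.M := by rw [tmap, ← D.n_def, ← D.M_eq]
  have hWe0 : W.e₀ = (tmap (D.h + 1))^[p] (tmap D.h D.m) := by
    rw [← hWφ, ← hlo, D.lo_eq]; rfl
  have hWe1 : W.e₁ = (tmap (D.h + 1))^[p] D.M := by
    rw [← hMh, ← hWφ, ← hlo1]; simp [Node.e₁, W, Node.child]
  have hVe0 : V.e₀ = (tmap (D.h + 1))^[p] (tmap (D.h + 1) (1 / (1 + 1 / (D.h - 1 + D.M)))) := by
    rw [← hVφ, ← hcast]; rfl
  have hVe1 : V.e₁ = (tmap (D.h + 1))^[p] (tmap (D.h + 1) (1 / (1 + D.M))) := by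
    rw [← hVφ, ← hlo1]; simp [Node.e₁, V, Node.child]
  have hWg := W.mid_eq
  have hVg := V.mid_eq
  have hWl := W.e₁_sub_e₀
  have hVl := V.e₁_sub_e₀
  have hWj : W.j = 1 := rfl
  have hVj : V.j = 1 := rfl
  have h11 : ((1 : ℕ) : ℝ) + 1 + D.m = 2 + D.m := by push_cast; ring
  rw [hWσ, hWφ, hWφ, hWj, h11, Nat.cast_one] at hWg
  rw [hVσ, hVφ, hVφ, hVj, h11, Nat.cast_one] at hVg
  rw [hWσ, hWe0, hWe1] at hWl
  rw [hVσ, hVe0, hVe1] at hVl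
  have i1 := left_ineq (D := D) hmob
  have i2 := right_ineq (D := D) hmob hr
  have i3 := gap_ineq (D := D) hmob hr
  have i4 := gap_ineq' (D := D) hmob
  rw [Function.iterate_succ_apply] at h2
  obtain ⟨x, ⟨u, hu, -, hu0, rfl⟩, y, ⟨v, hv, -, hv0, rfl⟩, h⟩ :=
    W.exists_add_eq V (by linarith) (by linarith) s
      ⟨(add_le_add (min_le_left _ _) (min_le_right _ _)).trans (by rw [hWe0, hVe1]; linarith),
        le_trans (by rw [hWe1, hVe0]; linarith) (add_le_add (le_max_right _ _) (le_max_left _ _))⟩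
  have hh1 := D.one_le_h
  have hu0' : u 0 ≤ D.H := hu0.trans W.t_le
  have hv0' : v 0 ≤ D.h - 1 := hv0
  have hu' : Adm D.h D.H (consSeq D.h u) := hu.consSeq hh1 hhH (by omega)
  have hU : Adm D.h D.H (consSeq 1 (consSeq D.h u)) :=
    hu'.consSeq le_rfl (by omega) fun _ => le_rfl
  have hV : Adm D.h D.H (consSeq 1 v) := hv.consSeq le_rfl (by omega) (by omega)
  have eU : cfVal (consSeq 1 (consSeq D.h u)) = 1 / (1 + 1 / (D.h + cfVal u)) := by
    rw [cfVal_consSeq le_rfl hu'.one_le, cfVal_consSeq hh1 hu.one_le, Nat.cast_one]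
  have eV : cfVal (consSeq 1 v) = 1 / (1 + cfVal v) := by
    rw [cfVal_consSeq le_rfl hv.one_le, Nat.cast_one]
  refine ⟨_, _, hU, hV, ?_, ?_⟩
  · rw [eU, eV]
    have hcu := cfVal_nonneg u hu.one_le
    have h4 : 1 / (D.h + cfVal u) ≤ 1 / D.h := by gcongr; linarith
    have h5 : 1 / ((D.h : ℝ) - 1 + 1) < cfVal v := by
      apply inv_lt_cfVal v hv.one_le
      rw [← hcast]
      exact_mod_cast hv0'
    rw [sub_add_cancel] at h5
    gcongr
    linarith
  · rw [eU, eV, ← h, hWφ, hVφ, Function.iterate_succ_apply]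
    rfl

end CoverData

lemma Adm.cfVal_le_tmap_zero {h H : ℕ} {u : ℕ → ℕ} (hh : 1 ≤ h) (hu : Adm h H u) :
    cfVal u ≤ tmap (h + 1) 0 := by
  have hh' : (1 : ℝ) ≤ h := by exact_mod_cast hh
  have h0 := hu.one_le
  have h1 : ∀ i, 1 ≤ u (i + 1) := fun i => h0 _
  have hc := cfVal_nonneg (fun i => u (i + 1)) h1
  have e : tmap (h + 1) 0 = 1 / (1 + 1 / (h + 1)) := by simp [tmap]
  rw [cfVal_eq u h0, e]
  have hlt : 1 / ((h : ℝ) + 1) ≤ 1 / 2 := one_div_le_one_div_of_le two_pos (by linarith)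
  apply one_div_le_one_div_of_le (by positivity)
  rcases (h0 0).eq_or_lt with h2 | h2
  · have h3 : 1 / ((h : ℝ) + 1) < cfVal fun i => u (i + 1) :=
      inv_lt_cfVal _ h1 (by exact_mod_cast (hu 0).2.2 h2.symm)
    rw [← h2]
    push_cast
    linarith
  · have : (2 : ℝ) ≤ u 0 := by exact_mod_cast h2
    linarith

lemma iterate_tmap_le_iterate_tmap {k : ℕ} (hk : 1 ≤ k) {x : ℝ} (hx : 0 ≤ x)
    (hx1 : x ≤ tmap k x) {i j : ℕ} (hij : i ≤ j) : (tmap k)^[i] x ≤ (tmap k)^[j] x := by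
  refine monotone_nat_of_le_succ (f := fun i => (tmap k)^[i] x) (fun i => ?_) hij
  rw [Function.iterate_succ_apply]
  exact iterate_tmap_mono hk hx hx1 i

lemma iterate_tmap_add_le {k : ℕ} (hk : 1 ≤ k) {a b : ℝ} (ha : 0 ≤ a) (hab : a ≤ b) (d : ℕ) :
    a + (tmap k)^[d] b ≤ (tmap k)^[d] a + b := by
  have h1 := (le_abs_self _).trans (abs_iterate_tmap_sub_le hk (ha.trans hab) ha d)
  rw [abs_of_nonneg (sub_nonneg.2 hab)] at h1
  have h2 : (1 / 4 : ℝ) ^ d * (b - a) ≤ 1 * (b - a) :=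
    mul_le_mul_of_nonneg_right (pow_le_one₀ (by norm_num) (by norm_num)) (sub_nonneg.2 hab)
  linarith

lemma iterate_tmap_add_iterate_tmap_le {k : ℕ} (hk : 1 ≤ k) {x y : ℝ} (hx : 0 ≤ x) (hy : 0 ≤ y)
    (hx1 : x ≤ tmap k 0) (hy1 : y ≤ tmap k 0) {m n : ℕ} (hmn : m = n ∨ n = m + 1 ∧ y ≤ x)
    {i j : ℕ} (hij : i + j = m + n) :
    (tmap k)^[i] x + (tmap k)^[j] y ≤ (tmap k)^[m] x + (tmap k)^[n] y := by
  have hxx : x ≤ tmap k x := hx1.trans (tmap_mono hk le_rfl hx)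
  have hyy : y ≤ tmap k y := hy1.trans (tmap_mono hk le_rfl hy)
  have hxy : x ≤ tmap k y := hx1.trans (tmap_mono hk le_rfl hy)
  have hyx : y ≤ tmap k x := hy1.trans (tmap_mono hk le_rfl hx)
  have step : ∀ {u v : ℝ}, 0 ≤ u → u ≤ tmap k v → ∀ i, (tmap k)^[i] u ≤ (tmap k)^[i + 1] v :=
    fun hu huv i => by
      rw [Function.iterate_succ_apply]
      exact iterate_tmap_mono hk hu huv i
  rcases lt_trichotomy i m with h | rfl | h
  · obtain ⟨d, rfl⟩ : ∃ d, m = d + i := ⟨m - i, by omega⟩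
    obtain rfl : j = d + n := by omega
    have key : (tmap k)^[i] x ≤ (tmap k)^[n] y :=
      (step hx hxy i).trans (iterate_tmap_le_iterate_tmap hk hy hyy (by omega))
    rw [Function.iterate_add_apply, Function.iterate_add_apply (tmap k) d i]
    exact iterate_tmap_add_le hk (iterate_tmap_nonneg hx i) key d
  · obtain rfl : j = n := by omega
    exact le_rfl
  · obtain ⟨d, rfl⟩ : ∃ d, n = d + j := ⟨n - j, by omega⟩
    obtain rfl : i = d + m := by omega
    have key : (tmap k)^[j] y ≤ (tmap k)^[m] x := by
      rcases hmn with hmn | ⟨hmn, hle⟩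
      · exact (step hy hyx j).trans (iterate_tmap_le_iterate_tmap hk hx hxx (by omega))
      · exact (iterate_tmap_mono hk hy hle j).trans
          (iterate_tmap_le_iterate_tmap hk hx hxx (by omega))
    rw [Function.iterate_add_apply, Function.iterate_add_apply (tmap k) d j]
    have := iterate_tmap_add_le hk (iterate_tmap_nonneg hy j) key d
    linarith

/-- Every `s ∈ [1, 2α)` is a sum of two values of sequences that consist of copies of `1, k`
followed by an admissible sequence, and it is the largest such sum that can be obtained by
moving copies of `1, k` from one side to the other. -/
theorem CoverData.exists_iterate_add_eq (D : CoverData) {α : ℝ} (hα : 0 ≤ α)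
    (hfix : tmap (D.h + 1) α = α) {s : ℝ} (hs : 1 ≤ s) (hsα : s < 2 * α) :
    ∃ m n U V, Adm D.h D.H U ∧ Adm D.h D.H V ∧
      s = (tmap (D.h + 1))^[m] (cfVal U) + (tmap (D.h + 1))^[n] (cfVal V) ∧
      ∀ i j, i + j = m + n →
        (tmap (D.h + 1))^[i] (cfVal U) + (tmap (D.h + 1))^[j] (cfVal V) ≤ s := by
  have hm0 := D.m_pos
  have hm := D.m_le
  have hh := D.one_le_h
  suffices h : ∃ m n U V, Adm D.h D.H U ∧ Adm D.h D.H V ∧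
      s = (tmap (D.h + 1))^[m] (cfVal U) + (tmap (D.h + 1))^[n] (cfVal V) ∧
      (m = n ∨ n = m + 1 ∧ cfVal V ≤ cfVal U) by
    obtain ⟨m, n, U, V, hU, hV, h1, h2⟩ := h
    refine ⟨m, n, U, V, hU, hV, h1, fun i j hij => ?_⟩
    rw [h1]
    exact iterate_tmap_add_iterate_tmap_le (by omega) (cfVal_nonneg _ hU.one_le)
      (cfVal_nonneg _ hV.one_le) (hU.cfVal_le_tmap_zero hh) (hV.cfVal_le_tmap_zero hh) h2 hij
  have hex : ∃ p, s < 2 * (tmap (D.h + 1))^[p] D.m :=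
    (((tendsto_iterate_tmap (by omega) hm0.le hα hfix).const_mul 2).eventually
      (lt_mem_nhds hsα)).exists
  classical
  have h1 := Nat.find_spec hex
  have h2 : ¬ Nat.find hex = 0 := fun h => by
    rw [h, Function.iterate_zero_apply] at h1
    linarith
  obtain ⟨p, hp⟩ := Nat.exists_eq_succ_of_ne_zero h2
  have h3 := not_lt.1 (Nat.find_min hex (m := p) (by omega))
  rw [hp] at h1
  rcases le_total s (2 * (tmap (D.h + 1))^[p] D.M) with h | h
  · obtain ⟨U, V, hU, hV, e⟩ := D.exists_add_eq_of_le p s h3 h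
    exact ⟨p, p, U, V, hU, hV, e, Or.inl rfl⟩
  · obtain ⟨U, V, hU, hV, hle, e⟩ := D.exists_add_eq_of_ge p s h h1.le
    exact ⟨p, p + 1, U, V, hU, hV, e, Or.inr ⟨rfl, hle⟩⟩

lemma cfVal_eq_iterate_tmap {k : ℕ} {z : ℤ → ℕ} (hz : ∀ i, 1 ≤ z i) {U : ℕ → ℕ} (c : ℤ)
    (hU : ∀ i : ℕ, z (c + 1 + i) = U i) (d : ℕ)
    (hd : ∀ j : ℕ, j < d → z (c - 2 * j) = k ∧ z (c - 2 * j - 1) = 1) :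
    cfVal (fun i : ℕ => z (c - 2 * d + 1 + i)) = (tmap k)^[d] (cfVal U) := by
  induction d with
  | zero => simp [hU]
  | succ d ih =>
    have h1 := hd d (by omega)
    rw [Function.iterate_succ_apply', ← ih fun j hj => hd j (by omega),
      cfVal_eq _ fun i => hz _, cfVal_eq _ fun i => hz _]
    have e1 : z (c - 2 * ((d + 1 : ℕ) : ℤ) + 1 + (0 : ℕ)) = 1 := by
      exact (congrArg z (by push_cast; ring)).trans h1.2
    have e2 : z (c - 2 * ((d + 1 : ℕ) : ℤ) + 1 + ((0 + 1 : ℕ) : ℤ)) = k := by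
      exact (congrArg z (by push_cast; ring)).trans h1.1
    have e3 : (fun i : ℕ => z (c - 2 * ((d + 1 : ℕ) : ℤ) + 1 + ((i + 1 + 1 : ℕ) : ℤ))) =
        fun i : ℕ => z (c - 2 * d + 1 + i) := by
      funext i; congr 1; push_cast; ring
    rw [e1, e2, e3, tmap, Nat.cast_one]

/-- The position `p` of `z` is safe for `t` if `λ ≤ t` holds at the corresponding position of every
sequence that agrees with `z` on `[-|p|, |p|]`. -/
def SafeAt (k : ℕ) (t : ℝ) (z : ℤ → ℕ) (p : ℤ) : Prop :=
  ∀ (η : ℤ → ℕ) (c : ℤ), (∀ i, 1 ≤ η i ∧ η i ≤ k) → (∀ q : ℤ, |q| ≤ |p| → η (c + q) = z q) →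
    lamCF η (c + p) ≤ t

lemma safeAt_of_lt {k : ℕ} {t : ℝ} {z : ℤ → ℕ} {p : ℤ} (ht : k + 1 ≤ t) (hp : z p < k) :
    SafeAt k t z p := by
  intro η c hη hz
  have h1 := lamCF_le_add_two η (fun i => (hη i).1) (c + p)
  have h2 : (z p : ℝ) + 1 ≤ k := by exact_mod_cast hp
  rw [hz p le_rfl] at h1
  linarith

lemma lamCF_le_of_two_le {η : ℤ → ℕ} (hη : ∀ i, 1 ≤ η i ∧ η i ≤ 4) {i : ℤ}
    (hi : 2 ≤ η (i - 1)) : lamCF η i ≤ 16 / 3 := by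
  have key : ∀ (a : ℕ → ℕ), (∀ n, 1 ≤ a n ∧ a n ≤ 4) →
      cfVal a ≤ 5 / 6 ∧ (2 ≤ a 0 → cfVal a ≤ 5 / 11) := by
    intro a ha
    have h1 : ∀ n, 1 ≤ a (n + 1) := fun n => (ha _).1
    have h2 : 1 / ((4 : ℝ) + 1) < cfVal fun n => a (n + 1) :=
      inv_lt_cfVal _ h1 (by exact_mod_cast (ha 1).2)
    have h3 : (1 : ℝ) ≤ a 0 := by exact_mod_cast (ha 0).1
    rw [cfVal_eq a fun n => (ha n).1]
    refine ⟨?_, fun h => ?_⟩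
    · rw [div_le_iff₀ (by linarith)]
      linarith
    · have h4 : (2 : ℝ) ≤ a 0 := by exact_mod_cast h
      rw [div_le_iff₀ (by linarith)]
      linarith
  have h1 := key (fun n => η (i + 1 + n)) fun n => hη _
  have h2 := key (fun n => η (i - 1 - n)) fun n => hη _
  have h3 : (η i : ℝ) ≤ 4 := by exact_mod_cast (hη i).2
  unfold lamCF
  simp only [Nat.cast_zero, add_zero, sub_zero] at h1 h2
  linarith [h1.1, h2.2 hi]

lemma safeAt_of_two_le_sub {t : ℝ} {z : ℤ → ℕ} {p : ℤ} (ht : 16 / 3 ≤ t) (hp : 0 < p)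
    (h : 2 ≤ z (p - 1)) : SafeAt 4 t z p := by
  intro η c hη hz
  refine (lamCF_le_of_two_le hη ?_).trans ht
  rwa [add_sub_assoc, hz]
  rw [abs_of_pos hp, abs_of_nonneg (by omega)]
  omega

/-- The concatenation of the windows `z (-N), …, z N` for `N = 0, 1, 2, …`; the window of `N`
occupies the positions from `N ^ 2` to `N ^ 2 + 2 * N`. -/
def windowSeq (z : ℤ → ℕ) (i : ℤ) : ℕ :=
  z (i - (Nat.sqrt i.toNat * Nat.sqrt i.toNat + Nat.sqrt i.toNat : ℕ))

lemma windowSeq_apply (z : ℤ → ℕ) (N : ℕ) {q : ℤ} (hq : |q| ≤ N) :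
    windowSeq z ((N * N + N : ℕ) + q) = z q := by
  have h := abs_le.1 hq
  have hs : Nat.sqrt (((N * N + N : ℕ) : ℤ) + q).toNat = N := by
    symm
    rw [Nat.eq_sqrt]
    constructor
    · zify; rw [Int.toNat_of_nonneg (by nlinarith)]; linarith
    · zify; rw [Int.toNat_of_nonneg (by nlinarith)]; linarith
  unfold windowSeq
  rw [hs]
  congr 1
  ring

lemma exists_window_of_le {a : ℕ} {i : ℤ} (hi : (a * a : ℕ) ≤ i) :
    ∃ (N : ℕ) (p : ℤ), a ≤ N ∧ |p| ≤ N ∧ i = (N * N + N : ℕ) + p := by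
  obtain ⟨j, rfl⟩ := Int.eq_ofNat_of_zero_le ((Int.natCast_nonneg _).trans hi)
  refine ⟨Nat.sqrt j, j - (Nat.sqrt j * Nat.sqrt j + Nat.sqrt j : ℕ), ?_, ?_, by ring⟩
  · exact Nat.le_sqrt.2 (by exact_mod_cast hi)
  · have h1 : ((Nat.sqrt j * Nat.sqrt j : ℕ) : ℤ) ≤ j := by exact_mod_cast Nat.sqrt_le j
    have h2 : (j : ℤ) ≤ (Nat.sqrt j * Nat.sqrt j + Nat.sqrt j + Nat.sqrt j : ℕ) := by
      exact_mod_cast Nat.sqrt_le_add j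
    rw [abs_le]
    push_cast at *
    constructor <;> linarith

/-- If all but finitely many positions of `z` are safe for `t = λ_0(z)` and `λ ≤ t` holds at the
others, then `t` belongs to the Lagrange spectrum. -/
lemma mem_LSpecK_of_safeAt {k : ℕ} {t : ℝ} {z : ℤ → ℕ} (hz : ∀ i, 1 ≤ z i ∧ z i ≤ k)
    (ht : lamCF z 0 = t) (hle : ∀ p, lamCF z p ≤ t ∨ SafeAt k t z p) (P : ℕ)
    (hP : ∀ p : ℤ, P < |p| → SafeAt k t z p) : t ∈ LSpecK k := by
  have hθ : ∀ i, 1 ≤ windowSeq z i ∧ windowSeq z i ≤ k := fun i => hz _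
  have hL : ∀ ε > 0, ∃ L : ℕ, 2 * (1 / 4 : ℝ) ^ L ≤ ε := fun ε hε => by
    obtain ⟨L, hL⟩ := exists_pow_lt_of_lt_one (half_pos hε) (by norm_num : (1 / 4 : ℝ) < 1)
    exact ⟨L, by linarith⟩
  have hclose : ∀ (L N : ℕ) (p : ℤ), |p| + 2 * L ≤ N →
      |lamCF (windowSeq z) ((N * N + N : ℕ) + p) - lamCF z p| ≤ 2 * (1 / 4) ^ L := by
    intro L N p hp
    refine abs_lamCF_sub_le L _ _ (fun i => (hθ i).1) (fun i => (hz i).1) _ _ fun q hq => ?_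
    rw [add_assoc, windowSeq_apply]
    exact (abs_add_le p q).trans (by linarith)
  refine ⟨windowSeq z, hθ, (limsup_eq_of_eventually_frequently (fun ε hε => ?_) fun ε hε => ?_).symm⟩
  · obtain ⟨L, hL⟩ := hL ε hε
    filter_upwards [eventually_ge_atTop (((P + 2 * L) * (P + 2 * L) : ℕ) : ℤ)] with i hi
    obtain ⟨N, p, hN, hp, rfl⟩ := exists_window_of_le hi
    by_cases hs : SafeAt k t z p
    · have := hs (windowSeq z) (N * N + N : ℕ) hθ fun q hq => windowSeq_apply z N (hq.trans hp)
      linarith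
    · have h1 : |p| ≤ P := not_lt.1 fun h => hs (hP p h)
      have h2 := (hle p).resolve_right hs
      have h3 := hclose L N p (by have : ((P + 2 * L : ℕ) : ℤ) ≤ N := by exact_mod_cast hN
                                  push_cast at this; linarith)
      linarith [(abs_le.1 h3).2]
  · obtain ⟨L, hL⟩ := hL ε hε
    rw [frequently_atTop]
    intro a
    set N := max (2 * L) a.toNat with hNdef
    refine ⟨((N * N + N : ℕ) : ℤ) + 0, ?_, ?_⟩
    · have h1 : a ≤ N := (Int.self_le_toNat a).trans (by exact_mod_cast le_max_right _ _)
      have h2 : (N : ℤ) ≤ (N * N + N : ℕ) := by exact_mod_cast Nat.le_add_left _ _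
      linarith
    · have h3 := hclose L N 0 (by
        rw [abs_zero, zero_add]; exact_mod_cast le_max_left _ _)
      rw [ht] at h3
      linarith [(abs_le.1 h3).1]

lemma tmap_sqrt {k : ℕ} (hk : 1 ≤ k) :
    0 ≤ (Real.sqrt ((k : ℝ) ^ 2 + 4 * k) - k) / 2 ∧
      tmap k ((Real.sqrt ((k : ℝ) ^ 2 + 4 * k) - k) / 2) =
        (Real.sqrt ((k : ℝ) ^ 2 + 4 * k) - k) / 2 := by
  have hk' : (1 : ℝ) ≤ k := by exact_mod_cast hk
  have h1 : (k : ℝ) ≤ Real.sqrt ((k : ℝ) ^ 2 + 4 * k) := Real.le_sqrt_of_sq_le (by linarith)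
  have h2 : Real.sqrt ((k : ℝ) ^ 2 + 4 * k) ^ 2 = (k : ℝ) ^ 2 + 4 * k := Real.sq_sqrt (by positivity)
  have h3 : 0 ≤ (Real.sqrt ((k : ℝ) ^ 2 + 4 * k) - k) / 2 := by linarith
  refine ⟨h3, ?_⟩
  rw [tmap_eq hk h3]
  have h4 : (k : ℝ) + 1 + (Real.sqrt ((k : ℝ) ^ 2 + 4 * k) - k) / 2 ≠ 0 := by linarith
  rw [one_sub_div h4, div_eq_iff h4]
  linear_combination -(1 / 4) * h2

/-- The sequence `…, V 1, V 0, k, 1, k, …, 1, k, U 0, U 1, …`, where the block between `V 0` and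
`U 0` occupies the positions from `-2 * n` to `2 * m`. -/
def spliceSeq (k m n : ℕ) (U V : ℕ → ℕ) (i : ℤ) : ℕ :=
  if 2 * m < i then U (i - 2 * m - 1).toNat
  else if i < -(2 * n) then V (-i - 2 * n - 1).toNat
  else if Even i then k else 1

section spliceSeq

variable {k m n : ℕ} {U V : ℕ → ℕ}

lemma spliceSeq_neg (i : ℤ) : spliceSeq k m n U V (-i) = spliceSeq k n m V U i := by
  unfold spliceSeq
  simp only [even_neg, neg_neg, neg_lt_neg_iff]
  by_cases h1 : 2 * (m : ℤ) < -i
  · have h2 : ¬ 2 * (n : ℤ) < i := by omega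
    have h3 : i < -(2 * m) := by omega
    simp [h1, h2, h3]
  · have h3 : ¬ i < -(2 * m) := by omega
    simp [h1, h3]

lemma spliceSeq_right (j : ℕ) : spliceSeq k m n U V (2 * m + 1 + j) = U j := by
  unfold spliceSeq
  rw [if_pos (by omega)]
  congr 1
  omega

lemma spliceSeq_even {q : ℤ} (h1 : -n ≤ q) (h2 : q ≤ m) : spliceSeq k m n U V (2 * q) = k := by
  unfold spliceSeq
  rw [if_neg (by omega), if_neg (by omega), if_pos (even_two_mul q)]

lemma spliceSeq_odd {q : ℤ} (h1 : -n ≤ q) (h2 : q < m) : spliceSeq k m n U V (2 * q + 1) = 1 := by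
  unfold spliceSeq
  rw [if_neg (by omega), if_neg (by omega),
    if_neg (Int.not_even_iff_odd.2 (odd_two_mul_add_one q))]

lemma spliceSeq_mem (hk : 1 ≤ k) (hU : ∀ i, 1 ≤ U i ∧ U i ≤ k) (hV : ∀ i, 1 ≤ V i ∧ V i ≤ k)
    (i : ℤ) : 1 ≤ spliceSeq k m n U V i ∧ spliceSeq k m n U V i ≤ k := by
  unfold spliceSeq
  split_ifs
  · exact hU _
  · exact hV _
  · exact ⟨hk, le_rfl⟩
  · exact ⟨le_rfl, hk⟩

lemma cfVal_spliceSeq (hk : 1 ≤ k) (hU : ∀ i, 1 ≤ U i ∧ U i ≤ k) (hV : ∀ i, 1 ≤ V i ∧ V i ≤ k)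
    {d e : ℕ} (hde : d + e = m + n) :
    cfVal (fun i : ℕ => spliceSeq k m n U V (2 * m - 2 * d + 1 + i)) =
      (tmap k)^[d] (cfVal U) := by
  refine cfVal_eq_iterate_tmap (fun i => (spliceSeq_mem hk hU hV i).1) (2 * m)
    spliceSeq_right d fun j hj => ⟨?_, ?_⟩
  · rw [← mul_sub]
    exact spliceSeq_even (by omega) (by omega)
  · rw [show 2 * (m : ℤ) - 2 * j - 1 = 2 * (m - j - 1) + 1 by ring]
    exact spliceSeq_odd (by omega) (by omega)

lemma lamCF_spliceSeq (hk : 1 ≤ k) (hU : ∀ i, 1 ≤ U i ∧ U i ≤ k) (hV : ∀ i, 1 ≤ V i ∧ V i ≤ k)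
    {d e : ℕ} (hde : d + e = m + n) :
    lamCF (spliceSeq k m n U V) (2 * m - 2 * d) =
      k + ((tmap k)^[d] (cfVal U) + (tmap k)^[e] (cfVal V)) := by
  have h1 := cfVal_spliceSeq hk hU hV hde
  have h2 := cfVal_spliceSeq hk hV hU (show e + d = n + m by omega)
  have h3 : (fun i : ℕ => spliceSeq k n m V U (2 * n - 2 * e + 1 + i)) =
      fun i : ℕ => spliceSeq k m n U V (2 * m - 2 * d - 1 - i) := by
    funext i
    rw [← spliceSeq_neg]
    congr 1
    omega
  rw [h3] at h2
  have h4 : spliceSeq k m n U V (2 * m - 2 * d) = k := by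
    rw [← mul_sub]
    exact spliceSeq_even (by omega) (by omega)
  rw [lamCF, h1, h2, h4, add_assoc]

lemma SafeAt.of_neg {t : ℝ} {z : ℤ → ℕ} {p : ℤ} (h : SafeAt k t (fun i => z (-i)) p) :
    SafeAt k t z (-p) := by
  intro η c hη hz
  have h1 := h (fun i => η (-i)) (-c) (fun i => hη _) fun q hq => by
    have := hz (-q) (by rwa [abs_neg, abs_neg])
    exact (congrArg η (by ring)).trans this
  rw [lamCF] at h1 ⊢
  have e1 : (fun i : ℕ => η (-(-c + p + 1 + i))) = fun i : ℕ => η (c + -p - 1 - i) := by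
    funext i
    congr 1
    ring
  have e2 : (fun i : ℕ => η (-(-c + p - 1 - i))) = fun i : ℕ => η (c + -p + 1 + i) := by
    funext i
    congr 1
    ring
  have e3 : η (-(-c + p)) = η (c + -p) := by
    congr 1
    ring
  rw [e1, e2, e3] at h1
  linarith

lemma safeAt_spliceSeq_right {h H : ℕ} {t : ℝ} (hk : 2 ≤ k) (hh : h + 1 = k) (hH : H ≤ k)
    (ht : k + 1 ≤ t) (hk4 : H < k ∨ k = 4 ∧ 16 / 3 ≤ t) (hU : Adm h H U) {p : ℤ}
    (hp : 2 * m < p) : SafeAt k t (spliceSeq k m n U V) p := by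
  obtain ⟨j, hj⟩ := Int.eq_ofNat_of_zero_le (show 0 ≤ p - (2 * m + 1) by omega)
  obtain rfl : p = 2 * m + 1 + j := by omega
  by_cases hlt : U j < k
  · exact safeAt_of_lt ht (by rwa [spliceSeq_right])
  · obtain ⟨rfl, ht4⟩ := hk4.resolve_left fun h4 => hlt ((hU j).2.1.trans_lt h4)
    refine safeAt_of_two_le_sub ht4 (by omega) ?_
    cases j with
    | zero =>
      rw [show 2 * (m : ℤ) + 1 + (0 : ℕ) - 1 = 2 * m by simp,
        spliceSeq_even (by omega) le_rfl]
      norm_num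
    | succ j =>
      rw [show 2 * (m : ℤ) + 1 + (j + 1 : ℕ) - 1 = 2 * m + 1 + j by push_cast; ring,
        spliceSeq_right]
      have h1 := hU j
      by_contra h2
      have := h1.2.2 (by omega)
      omega

end spliceSeq

lemma mem_LSpecK_of_lt {k : ℕ} (hk : 4 ≤ k) {t : ℝ} (h1 : k + 1 + 2 / (k + 2) ≤ t)
    (h2 : t < Real.sqrt ((k : ℝ) ^ 2 + 4 * k)) : t ∈ LSpecK k := by
  obtain ⟨D, hDh, hDH, hD4⟩ : ∃ D : CoverData, D.h + 1 = k ∧ D.H ≤ k ∧ (D.H < k ∨ k = 4) := by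
    rcases hk.eq_or_lt with rfl | h5
    · obtain ⟨D, hD1, hD2⟩ := exists_coverData_four
      exact ⟨D, hD1, hD2, Or.inr rfl⟩
    · obtain ⟨D, hD1, hD2⟩ := exists_coverData_of_four_le (h := k - 1) (by omega)
      exact ⟨D, by omega, by omega, Or.inl (by omega)⟩
  have hk' : (4 : ℝ) ≤ k := by exact_mod_cast hk
  obtain ⟨hα0, hα⟩ := tmap_sqrt (show 1 ≤ k by omega)
  have h3 : (0 : ℝ) < 2 / (k + 2) := by positivity
  obtain ⟨m, n, U, V, hU, hV, hs, hmax⟩ := D.exists_iterate_add_eq hα0 (hDh ▸ hα)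
    (s := t - k) (by linarith) (by linarith)
  rw [hDh] at hs hmax
  have hU' : ∀ i, 1 ≤ U i ∧ U i ≤ k := fun i => ⟨(hU i).1, (hU i).2.1.trans hDH⟩
  have hV' : ∀ i, 1 ≤ V i ∧ V i ≤ k := fun i => ⟨(hV i).1, (hV i).2.1.trans hDH⟩
  have ht : (k : ℝ) + 1 ≤ t := by linarith
  have hk4 : D.H < k ∨ k = 4 ∧ 16 / 3 ≤ t := hD4.imp_right fun h => by
    subst h
    norm_num at h1
    exact ⟨rfl, h1⟩
  have hright : ∀ p : ℤ, 2 * m < p → SafeAt k t (spliceSeq k m n U V) p := fun p hp =>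
    safeAt_spliceSeq_right (by omega) hDh hDH ht hk4 hU hp
  have hleft : ∀ p : ℤ, p < -(2 * n) → SafeAt k t (spliceSeq k m n U V) p := fun p hp => by
    rw [← neg_neg p]
    refine SafeAt.of_neg ?_
    simp only [spliceSeq_neg]
    exact safeAt_spliceSeq_right (by omega) hDh hDH ht hk4 hV (by omega)
  refine mem_LSpecK_of_safeAt (spliceSeq_mem (m := m) (n := n) (by omega) hU' hV') ?_
    (fun p => ?_) (2 * m + 2 * n) fun p hp => ?_
  · have := lamCF_spliceSeq (show 1 ≤ k by omega) hU' hV' (rfl : m + n = m + n)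
    rw [sub_self, ← hs] at this
    rw [this]
    ring
  · by_cases hp1 : 2 * m < p
    · exact Or.inr (hright p hp1)
    by_cases hp2 : p < -(2 * n)
    · exact Or.inr (hleft p hp2)
    obtain ⟨q, rfl | rfl⟩ := Int.even_or_odd' p
    · left
      obtain ⟨d, hd⟩ := Int.eq_ofNat_of_zero_le (show 0 ≤ m - q by omega)
      obtain ⟨e, he⟩ := Int.eq_ofNat_of_zero_le (show 0 ≤ n + q by omega)
      obtain rfl : q = m - d := by omega
      have hde : d + e = m + n := by omega
      have := lamCF_spliceSeq (show 1 ≤ k by omega) hU' hV' hde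
      rw [mul_sub, this]
      linarith [hmax d e hde]
    · refine Or.inr (safeAt_of_lt ht ?_)
      rw [spliceSeq_odd (by omega) (by omega)]
      omega
  · rcases lt_abs.1 hp with h | h
    · exact hright p (by push_cast at h; omega)
    · exact hleft p (by push_cast at h; omega)

lemma cfVal_le_iterate_tmap {k : ℕ} (hk : 1 ≤ k) (p : ℕ) (a : ℕ → ℕ)
    (ha : ∀ i, 1 ≤ a i ∧ a i ≤ k) : cfVal a ≤ (tmap k)^[p] 1 := by
  induction p generalizing a with
  | zero => exact (cfVal_lt_one a fun i => (ha i).1).le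
  | succ p ih =>
    have h1 : cfVal a ≤ tmap k (cfVal fun i => a (i + 1 + 1)) := by
      have h0 := cfVal_nonneg (fun i => a (i + 1 + 1)) fun i => (ha _).1
      have h2 : (1 : ℝ) ≤ a 0 := by exact_mod_cast (ha 0).1
      have h3 : (1 : ℝ) ≤ a (0 + 1) := by exact_mod_cast (ha (0 + 1)).1
      have h4 : (a (0 + 1) : ℝ) ≤ k := by exact_mod_cast (ha (0 + 1)).2
      rw [cfVal_eq a fun i => (ha i).1, cfVal_eq (fun i => a (i + 1)) fun i => (ha _).1, tmap]
      gcongr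
    rw [Function.iterate_succ_apply']
    exact h1.trans (tmap_mono hk (cfVal_nonneg _ fun i => (ha _).1) (ih _ fun i => ha _))

lemma cfVal_le_of_tmap_eq {k : ℕ} (hk : 1 ≤ k) {α : ℝ} (hα : 0 ≤ α) (hfix : tmap k α = α)
    (a : ℕ → ℕ) (ha : ∀ i, 1 ≤ a i ∧ a i ≤ k) : cfVal a ≤ α :=
  ge_of_tendsto' (tendsto_iterate_tmap hk zero_le_one hα hfix) fun p =>
    cfVal_le_iterate_tmap hk p a ha

lemma lamCF_le_sqrt {k : ℕ} (hk : 1 ≤ k) (θ : ℤ → ℕ) (hθ : ∀ i, 1 ≤ θ i ∧ θ i ≤ k) (i : ℤ) :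
    lamCF θ i ≤ Real.sqrt ((k : ℝ) ^ 2 + 4 * k) := by
  obtain ⟨hα0, hα⟩ := tmap_sqrt hk
  have h1 := cfVal_le_of_tmap_eq hk hα0 hα (fun n : ℕ => θ (i + 1 + n)) fun _ => hθ _
  have h2 := cfVal_le_of_tmap_eq hk hα0 hα (fun n : ℕ => θ (i - 1 - n)) fun _ => hθ _
  have h3 : (θ i : ℝ) ≤ k := by exact_mod_cast (hθ i).2
  unfold lamCF
  linarith

lemma isCoboundedUnder_lamCF {θ : ℤ → ℕ} (hθ : ∀ i, 1 ≤ θ i) :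
    IsCoboundedUnder (· ≤ ·) atTop (lamCF θ) :=
  IsCoboundedUnder.of_frequently_ge (a := 0) <| Eventually.frequently <| Eventually.of_forall
    fun i => (Nat.cast_nonneg _).trans (lt_lamCF θ hθ i).le

lemma LSpecK_subset {k : ℕ} (hk : 1 ≤ k) :
    LSpecK k ⊆ LSpec ∩ Iic (Real.sqrt ((k : ℝ) ^ 2 + 4 * k)) := by
  rintro t ⟨θ, hθ, rfl⟩
  have h1 : ∀ i, lamCF θ i ≤ Real.sqrt ((k : ℝ) ^ 2 + 4 * k) := lamCF_le_sqrt hk θ hθ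
  exact ⟨⟨θ, fun i => (hθ i).1, isBoundedUnder_of ⟨_, h1⟩, rfl⟩,
    limsup_le_of_le (isCoboundedUnder_lamCF fun i => (hθ i).1) (Eventually.of_forall h1)⟩

/-- Only the eventual size of the partial quotients matters for the Lagrange value. -/
lemma limsup_lamCF_mem_LSpecK {k : ℕ} (hk : 1 ≤ k) {θ : ℤ → ℕ} (hθ : ∀ i, 1 ≤ θ i)
    (hb : IsBoundedUnder (· ≤ ·) atTop (lamCF θ)) (h : ∀ᶠ i in atTop, θ i ≤ k) :
    limsup (lamCF θ) atTop ∈ LSpecK k := by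
  obtain ⟨a, ha⟩ := eventually_atTop.1 h
  have hη : ∀ i, 1 ≤ min (θ i) k ∧ min (θ i) k ≤ k := fun i =>
    ⟨le_min (hθ i) hk, min_le_right _ _⟩
  have hclose : ∀ ε > 0, ∀ᶠ i in atTop, |lamCF θ i - lamCF (fun i => min (θ i) k) i| ≤ ε := by
    intro ε hε
    obtain ⟨L, hL⟩ := exists_pow_lt_of_lt_one (half_pos hε) (by norm_num : (1 / 4 : ℝ) < 1)
    filter_upwards [eventually_ge_atTop (a + 2 * L)] with i hi
    refine (abs_lamCF_sub_le L _ _ hθ (fun i => (hη i).1) i i fun q hq => ?_).trans (by linarith)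
    exact (min_eq_left (ha _ (by have := (abs_le.1 hq).1; linarith))).symm
  refine ⟨fun i => min (θ i) k, hη, (limsup_eq_of_eventually_frequently (fun ε hε => ?_)
    fun ε hε => ?_).symm⟩
  · filter_upwards [hclose (ε / 2) (half_pos hε),
      eventually_lt_of_limsup_lt (lt_add_of_pos_right _ (half_pos hε)) hb] with i h1 h2
    linarith [(abs_le.1 h1).1]
  · have h1 := frequently_lt_of_lt_limsup (isCoboundedUnder_lamCF hθ)
      (sub_lt_self (limsup (lamCF θ) atTop) (half_pos hε))
    refine (h1.and_eventually (hclose (ε / 2) (half_pos hε))).mono fun i h2 => ?_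
    linarith [(abs_le.1 h2.2).2]

lemma le_limsup_lamCF {k : ℕ} {θ : ℤ → ℕ} (hθ : ∀ i, 1 ≤ θ i)
    (hb : IsBoundedUnder (· ≤ ·) atTop (lamCF θ)) (h1 : ∀ᶠ i in atTop, θ i ≤ k + 1)
    (h2 : ∃ᶠ i in atTop, k < θ i) :
    k + 1 + 2 / ((k : ℝ) + 2) ≤ limsup (lamCF θ) atTop := by
  obtain ⟨a, ha⟩ := eventually_atTop.1 h1
  refine le_limsup_of_frequently_le ((h2.and_eventually (eventually_ge_atTop (a + 1))).mono
    fun i hi => ?_) hb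
  have e1 : (θ (i + 1) : ℝ) ≤ k + 1 := by exact_mod_cast ha (i + 1) (by linarith [hi.2])
  have e2 : (θ (i - 1) : ℝ) ≤ k + 1 := by exact_mod_cast ha (i - 1) (by linarith [hi.2])
  have e3 : (k : ℝ) + 1 ≤ θ i := by exact_mod_cast hi.1
  have h3 := inv_lt_cfVal (fun n : ℕ => θ (i + 1 + n)) (fun _ => hθ _) (by simpa using e1)
  have h4 := inv_lt_cfVal (fun n : ℕ => θ (i - 1 - n)) (fun _ => hθ _) (by simpa using e2)
  have h5 : (2 : ℝ) / (k + 2) = 1 / (k + 1 + 1) + 1 / (k + 1 + 1) := by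
    rw [← add_div, add_assoc]
    norm_num
  unfold lamCF
  linarith

lemma sqrt_mem_LSpecK {k : ℕ} (hk : 1 ≤ k) : Real.sqrt ((k : ℝ) ^ 2 + 4 * k) ∈ LSpecK k := by
  set θ : ℤ → ℕ := fun i => if Even i then k else 1 with hθdef
  have hθ : ∀ i, 1 ≤ θ i ∧ θ i ≤ k := fun i => by
    simp only [hθdef]
    split_ifs <;> omega
  obtain ⟨hα0, hα⟩ := tmap_sqrt hk
  set α := (Real.sqrt ((k : ℝ) ^ 2 + 4 * k) - k) / 2 with hαdef
  have key : ∀ a : ℕ → ℕ, (∀ i, a i = if Even i then 1 else k) → cfVal a = α := by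
    intro a ha
    have ha1 : ∀ i, 1 ≤ a i := fun i => by
      rw [ha]
      split_ifs <;> omega
    refine tendsto_nhds_unique ?_ (tendsto_iterate_tmap hk (cfVal_nonneg a ha1) hα0 hα)
    have hfix : tmap k (cfVal a) = cfVal a := by
      have h1 : (fun i => a (i + 1 + 1)) = a := by
        funext i
        simp only [ha, Nat.even_add_one, not_not]
      conv_rhs => rw [cfVal_eq a ha1, cfVal_eq (fun i => a (i + 1)) fun i => ha1 _, h1]
      simp [tmap, ha]
    simp only [Function.iterate_fixed hfix]
    exact tendsto_const_nhds
  refine ⟨θ, hθ, (limsup_eq_of_eventually_frequently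
    (fun ε hε => Eventually.of_forall fun i => ?_) fun ε hε => ?_).symm⟩
  · linarith [lamCF_le_sqrt hk θ hθ i]
  · rw [frequently_atTop]
    intro a
    refine ⟨2 * |a|, by linarith [le_abs_self a, abs_nonneg a], ?_⟩
    have h1 : cfVal (fun n : ℕ => θ (2 * |a| + 1 + n)) = α := key _ fun i => by
      have : Even (2 * |a| + 1 + (i : ℤ)) ↔ ¬ Even i := by grind
      simp only [hθdef, this, ite_not]
    have h2 : cfVal (fun n : ℕ => θ (2 * |a| - 1 - n)) = α := key _ fun i => by
      have : Even (2 * |a| - 1 - (i : ℤ)) ↔ ¬ Even i := by grind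
      simp only [hθdef, this, ite_not]
    have h3 : θ (2 * |a|) = k := if_pos (even_two_mul _)
    rw [lamCF, h1, h2, h3]
    linarith

/-- For every integer `k ≥ 2` with `k ≠ 3`, the Lagrange spectrum of continued
fractions with partial quotients bounded by `k` is an initial segment of the
classical Lagrange spectrum: `L(k) = L ∩ (-∞, √(k² + 4k)]`. -/
theorem lagrange_initial_segment (k : ℕ) (hk : 2 ≤ k) (hk3 : k ≠ 3) :
    LSpecK k = LSpec ∩ Set.Iic (Real.sqrt ((k : ℝ) ^ 2 + 4 * k)) := by
  refine (LSpecK_subset (by omega)).antisymm ?_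
  rintro t ⟨⟨θ, hθ, hb, rfl⟩, ht⟩
  rw [mem_Iic] at ht
  by_cases h1 : ∀ᶠ i in atTop, θ i ≤ k
  · exact limsup_lamCF_mem_LSpecK (by omega) hθ hb h1
  have h2 : ∃ᶠ i in atTop, k < θ i := by
    simpa only [Filter.not_eventually, not_le] using h1
  have hk0 : (0 : ℝ) ≤ k := k.cast_nonneg
  have h3 : ∀ᶠ i in atTop, θ i ≤ k + 1 := by
    by_contra h4
    have h5 : ∃ᶠ i in atTop, ((k : ℝ) + 2) ≤ lamCF θ i := by
      refine (Filter.not_eventually.1 h4).mono fun i hi => ?_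
      have h6 : (k : ℝ) + 2 ≤ θ i := by exact_mod_cast not_le.1 hi
      exact h6.trans (lt_lamCF θ hθ i).le
    have h7 := (le_limsup_of_frequently_le h5 hb).trans ht
    rw [Real.le_sqrt' (by positivity)] at h7
    linarith
  have h4 := le_limsup_lamCF hθ hb h3 h2
  rcases hk.eq_or_lt with rfl | hk2
  · have h5 := h4.trans ht
    rw [Real.le_sqrt' (by positivity)] at h5
    norm_num at h5
  · rcases ht.eq_or_lt with h5 | h5
    · rw [h5]
      exact sqrt_mem_LSpecK (by omega)
    · exact mem_LSpecK_of_lt (by omega) h4 h5
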